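/- arXiv:2510.07450 — 2 statements merged into one kernel-verified Lean document; each statement's English description precedes it below -/
import Mathlib

section
/- Let a ∈ (0,1), δ ∈ [0,1), let (u_n) be a δ-sublacunary sequence of positive reals with u_1 ≥ 1, and (I_n) intervals in [0,1] with λ(I_n) = n^{-a}. For y ∈ [0,1] define Λ_y = {n ∈ ℕ : frac(u_n y) ∈ I_n}. Let A ⊆ ℕ satisfy δ + a < dim̄_M(A). Then for Lebesgue almost every y ∈ [0,1], dim̄_M(A ∩ Λ_y) = dim̄_M(A) − a, where dim̄_M denotes the upper mass dimension. -/
open MeasureTheory Filter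

/-- Upper mass dimension of a set of naturals. -/
noncomputable def upperMassDim (A : Set ℕ) : ℝ :=
  Filter.limsup (fun N : ℕ => Real.log ((A ∩ Set.Icc 1 N).ncard : ℝ) / Real.log N) atTop

theorem volumeReal_Icc_inter_fract_le {u p q s t : ℝ} (hu : 0 < u) (hpq : p ≤ q) (hst : s ≤ t) :
    volume.real (Set.Icc s t ∩ {y | Int.fract (u * y) ∈ Set.Icc p q}) ≤
      (q - p) * (t - s) + 2 * (q - p) / u := by
  have hsub : Set.Icc s t ∩ {y | Int.fract (u * y) ∈ Set.Icc p q} ⊆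
      ⋃ k ∈ Finset.Icc ⌊u * s⌋ ⌊u * t⌋, Set.Icc ((k + p) / u) ((k + q) / u) := by
    rintro y ⟨⟨hs, ht⟩, hp, hq⟩
    simp only [Set.mem_iUnion, Finset.mem_Icc]
    refine ⟨⌊u * y⌋, ⟨Int.floor_mono (by gcongr), Int.floor_mono (by gcongr)⟩, ?_, ?_⟩
    · rw [div_le_iff₀ hu]; unfold Int.fract at hp; linarith
    · rw [le_div_iff₀ hu]; unfold Int.fract at hq; linarith
  have hfin : volume (⋃ k ∈ Finset.Icc ⌊u * s⌋ ⌊u * t⌋,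
      Set.Icc (((k : ℝ) + p) / u) ((k + q) / u)) ≠ ⊤ :=
    ((Finset.Icc ⌊u * s⌋ ⌊u * t⌋).isCompact_biUnion fun _ _ => isCompact_Icc).measure_ne_top
  have hcard : ((Finset.Icc ⌊u * s⌋ ⌊u * t⌋).card : ℝ) ≤ u * (t - s) + 2 := by
    have h0 : ⌊u * s⌋ ≤ ⌊u * t⌋ := Int.floor_mono (by gcongr)
    have h1 : ((Finset.Icc ⌊u * s⌋ ⌊u * t⌋).card : ℤ) = ⌊u * t⌋ + 1 - ⌊u * s⌋ := by
      rw [Int.card_Icc]; omega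
    have h2 : ((Finset.Icc ⌊u * s⌋ ⌊u * t⌋).card : ℝ) = ⌊u * t⌋ + 1 - ⌊u * s⌋ := by
      exact_mod_cast h1
    rw [h2]
    linarith [Int.floor_le (u * t), Int.lt_floor_add_one (u * s)]
  calc _ ≤ _ := measureReal_mono hsub hfin
    _ ≤ ∑ k ∈ Finset.Icc ⌊u * s⌋ ⌊u * t⌋, volume.real (Set.Icc (((k : ℝ) + p) / u) ((k + q) / u)) :=
        measureReal_biUnion_finset_le _ _
    _ = (Finset.Icc ⌊u * s⌋ ⌊u * t⌋).card * ((q - p) / u) := by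
        rw [Finset.sum_congr rfl (g := fun _ => (q - p) / u), Finset.sum_const, nsmul_eq_mul]
        intro k _
        rw [Real.volume_real_Icc_of_le (by gcongr)]
        ring
    _ ≤ (u * (t - s) + 2) * ((q - p) / u) := by
        gcongr
    _ = _ := by field_simp

theorem le_volumeReal_Icc_inter_fract {u p q : ℝ} (hu : 0 < u) (hp : 0 ≤ p) (hpq : p ≤ q)
    (hq : q ≤ 1) :
    (q - p) * (1 - 1 / u) ≤
      volume.real (Set.Icc 0 1 ∩ {y | Int.fract (u * y) ∈ Set.Icc p q}) := by
  have hsub : (⋃ k ∈ Finset.range ⌊u⌋₊, Set.Ico (((k : ℝ) + p) / u) ((k + q) / u)) ⊆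
      Set.Icc 0 1 ∩ {y | Int.fract (u * y) ∈ Set.Icc p q} := by
    intro y hy
    simp only [Set.mem_iUnion, Finset.mem_range] at hy
    obtain ⟨k, hk, h1, h2⟩ := hy
    rw [div_le_iff₀ hu] at h1
    rw [lt_div_iff₀ hu] at h2
    have hk' : (k : ℝ) + 1 ≤ u := by
      have : ((k + 1 : ℕ) : ℝ) ≤ u := (Nat.cast_le.mpr hk).trans (Nat.floor_le hu.le)
      exact_mod_cast this
    have hfl : ⌊u * y⌋ = k := by
      rw [Int.floor_eq_iff]; push_cast; constructor <;> linarith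
    have hk0 : (0 : ℝ) ≤ k := k.cast_nonneg
    refine ⟨⟨by nlinarith, by nlinarith⟩, ?_⟩
    rw [Set.mem_ofPred_eq, Int.fract, hfl]
    push_cast
    constructor <;> linarith
  have hdisj : Set.PairwiseDisjoint (Finset.range ⌊u⌋₊ : Set ℕ)
      (fun k : ℕ => Set.Ico (((k : ℝ) + p) / u) ((k + q) / u)) := by
    intro k _ l _ hkl
    rw [Function.onFun, Set.disjoint_left]
    rintro y ⟨h1, h2⟩ ⟨h3, h4⟩
    rw [div_le_iff₀ hu] at h1 h3
    rw [lt_div_iff₀ hu] at h2 h4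
    have e1 : (k : ℝ) < l + 1 := by linarith
    have e2 : (l : ℝ) < k + 1 := by linarith
    have e1' : k < l + 1 := by exact_mod_cast e1
    have e2' : l < k + 1 := by exact_mod_cast e2
    omega
  have hfin : volume (Set.Icc 0 1 ∩ {y : ℝ | Int.fract (u * y) ∈ Set.Icc p q}) ≠ ⊤ :=
    measure_ne_top_of_subset Set.inter_subset_left isCompact_Icc.measure_ne_top
  calc (q - p) * (1 - 1 / u) = (u - 1) * ((q - p) / u) := by field_simp
    _ ≤ ⌊u⌋₊ * ((q - p) / u) := by
        gcongr
        linarith [Nat.lt_floor_add_one u]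
    _ = ∑ k ∈ Finset.range ⌊u⌋₊, volume.real (Set.Ico (((k : ℝ) + p) / u) ((k + q) / u)) := by
        rw [Finset.sum_congr rfl (g := fun _ => (q - p) / u), Finset.sum_const, nsmul_eq_mul,
          Finset.card_range]
        intro k _
        rw [Real.volume_real_Ico_of_le (by gcongr)]
        ring
    _ = _ := (measureReal_biUnion_finset hdisj (fun _ _ => measurableSet_Ico)
        (fun _ _ => by simp)).symm
    _ ≤ _ := measureReal_mono hsub hfin

theorem volumeReal_Icc_inter_fract_inter_fract_le {u v p q p' q' : ℝ} (hu : 0 < u) (hv : 0 < v)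
    (hpq : p ≤ q) (hpq' : p' ≤ q') :
    volume.real (Set.Icc 0 1 ∩ ({y | Int.fract (u * y) ∈ Set.Icc p q} ∩
      {y | Int.fract (v * y) ∈ Set.Icc p' q'})) ≤
      (u + 1) * ((q' - p') * ((q - p) / u) + 2 * (q' - p') / v) := by
  set F := {y : ℝ | Int.fract (v * y) ∈ Set.Icc p' q'} with hF
  have hsub : Set.Icc 0 1 ∩ ({y | Int.fract (u * y) ∈ Set.Icc p q} ∩ F) ⊆
      ⋃ k ∈ Finset.range (⌊u⌋₊ + 1), (Set.Icc (((k : ℝ) + p) / u) ((k + q) / u) ∩ F) := by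
    rintro y ⟨⟨h0, h1⟩, ⟨hp, hq⟩, hy⟩
    have huy : 0 ≤ u * y := by positivity
    simp only [Set.mem_iUnion, Finset.mem_range]
    have hfr : Int.fract (u * y) = u * y - ⌊u * y⌋₊ := by
      rw [Int.fract, natCast_floor_eq_intCast_floor huy]
    rw [hfr] at hp hq
    refine ⟨⌊u * y⌋₊, Nat.lt_succ_of_le (Nat.floor_mono (by nlinarith)), ⟨?_, ?_⟩, hy⟩
    · rw [div_le_iff₀ hu]; linarith
    · rw [le_div_iff₀ hu]; linarith
  have hfin : volume (⋃ k ∈ Finset.range (⌊u⌋₊ + 1),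
      (Set.Icc (((k : ℝ) + p) / u) ((k + q) / u) ∩ F)) ≠ ⊤ := by
    refine measure_ne_top_of_subset (Set.iUnion₂_mono fun k _ => Set.inter_subset_left)
      ((Finset.range (⌊u⌋₊ + 1)).isCompact_biUnion fun _ _ => isCompact_Icc).measure_ne_top
  calc _ ≤ _ := measureReal_mono hsub hfin
    _ ≤ ∑ k ∈ Finset.range (⌊u⌋₊ + 1),
          volume.real (Set.Icc (((k : ℝ) + p) / u) ((k + q) / u) ∩ F) :=
        measureReal_biUnion_finset_le _ _
    _ ≤ ∑ _k ∈ Finset.range (⌊u⌋₊ + 1), ((q' - p') * ((q - p) / u) + 2 * (q' - p') / v) := by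
        gcongr with k _
        refine (volumeReal_Icc_inter_fract_le hv hpq' (by gcongr)).trans_eq ?_
        ring
    _ = (⌊u⌋₊ + 1) * ((q' - p') * ((q - p) / u) + 2 * (q' - p') / v) := by
        rw [Finset.sum_const, nsmul_eq_mul, Finset.card_range]; push_cast; rfl
    _ ≤ _ := by
        have h1 : 0 ≤ q - p := by linarith
        have h2 : 0 ≤ q' - p' := by linarith
        gcongr
        exact Nat.floor_le hu.le

theorem mul_pow_le_of_sublacunary {u : ℕ → ℝ} (hu : ∀ n, 0 < u n) {c δ : ℝ} (hc : 0 ≤ c)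
    (hδ : 0 ≤ δ) (hsub : ∀ n : ℕ, 1 ≤ n → u (n + 1) / u n ≥ 1 + c * (n : ℝ) ^ (-δ))
    {m n N : ℕ} (hm : 1 ≤ m) (hmn : m ≤ n) (hnN : n ≤ N) :
    u m * (1 + c * (N : ℝ) ^ (-δ)) ^ (n - m) ≤ u n := by
  induction n, hmn using Nat.le_induction with
  | base => simp
  | succ n hmn ih =>
    have h1 := ih (by omega)
    have h2 := hsub n (by omega)
    rw [ge_iff_le, le_div_iff₀ (hu n)] at h2
    have hn : (0 : ℝ) < n := by exact_mod_cast (by omega : 0 < n)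
    have h3 : (N : ℝ) ^ (-δ) ≤ (n : ℝ) ^ (-δ) :=
      Real.rpow_le_rpow_of_nonpos hn (by exact_mod_cast (by omega : n ≤ N)) (by linarith)
    have h4 : 0 ≤ (N : ℝ) ^ (-δ) := by positivity
    rw [Nat.succ_sub hmn, pow_succ, ← mul_assoc]
    calc _ ≤ u n * (1 + c * (N : ℝ) ^ (-δ)) := by gcongr
      _ ≤ u n * (1 + c * (n : ℝ) ^ (-δ)) := by have := hu n; gcongr
      _ ≤ _ := by linarith

theorem measureReal_sum_indicator_lt_le {Ω : Type*} [MeasurableSpace Ω] {μ : Measure Ω}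
    [IsProbabilityMeasure μ] (s : Finset ℕ) {E : ℕ → Set Ω} (hE : ∀ n ∈ s, MeasurableSet (E n))
    {L G : ℝ} (hL : 0 < L) (h1 : L - G ≤ ∑ n ∈ s, μ.real (E n))
    (h2 : ∑ m ∈ s, ∑ n ∈ s, μ.real (E m ∩ E n) ≤ L ^ 2 + 10 * L * G) :
    μ.real {y | ∑ n ∈ s, (E n).indicator 1 y < L / 2} ≤ 48 * G / L := by
  have i1 : ∀ n ∈ s, Integrable ((E n).indicator (1 : Ω → ℝ)) μ := fun n hn =>
    (integrable_const (1 : ℝ)).indicator (hE n hn)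
  have i2 : ∀ m ∈ s, ∀ n ∈ s, Integrable ((E m ∩ E n).indicator (1 : Ω → ℝ)) μ := fun m hm n hn =>
    (integrable_const (1 : ℝ)).indicator ((hE m hm).inter (hE n hn))
  have hexp : ∀ y, (∑ n ∈ s, (E n).indicator (1 : Ω → ℝ) y - L) ^ 2 =
      ∑ m ∈ s, ∑ n ∈ s, (E m ∩ E n).indicator (1 : Ω → ℝ) y -
        2 * L * ∑ n ∈ s, (E n).indicator (1 : Ω → ℝ) y + L ^ 2 := by
    intro y
    simp only [Set.inter_indicator_one, Pi.mul_apply, ← Finset.sum_mul_sum]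
    ring
  have j2 : Integrable (fun y => ∑ m ∈ s, ∑ n ∈ s, (E m ∩ E n).indicator (1 : Ω → ℝ) y) μ :=
    integrable_finsetSum _ fun m hm => integrable_finsetSum _ fun n hn => i2 m hm n hn
  have j1 : Integrable (fun y => 2 * L * ∑ n ∈ s, (E n).indicator (1 : Ω → ℝ) y) μ :=
    (integrable_finsetSum _ i1).const_mul _
  have hint : Integrable (fun y => (∑ n ∈ s, (E n).indicator (1 : Ω → ℝ) y - L) ^ 2) μ := by
    simp only [hexp]
    exact (j2.sub j1).add (integrable_const _)
  have hval : ∫ y, (∑ n ∈ s, (E n).indicator (1 : Ω → ℝ) y - L) ^ 2 ∂μ ≤ 12 * L * G := by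
    simp only [hexp]
    have hadd := integral_add (j2.sub j1) (integrable_const (L ^ 2))
    simp only [Pi.sub_apply] at hadd
    rw [hadd, integral_sub j2 j1, integral_const_mul,
      integral_finsetSum _ i1,
      integral_finsetSum _ (fun m hm => integrable_finsetSum _ fun n hn => i2 m hm n hn)]
    have e1 : ∑ n ∈ s, ∫ y, (E n).indicator (1 : Ω → ℝ) y ∂μ = ∑ n ∈ s, μ.real (E n) :=
      Finset.sum_congr rfl fun n hn => integral_indicator_one (hE n hn)
    have e2 : ∑ m ∈ s, ∫ y, ∑ n ∈ s, (E m ∩ E n).indicator (1 : Ω → ℝ) y ∂μ =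
        ∑ m ∈ s, ∑ n ∈ s, μ.real (E m ∩ E n) := by
      refine Finset.sum_congr rfl fun m hm => ?_
      rw [integral_finsetSum _ (i2 m hm)]
      exact Finset.sum_congr rfl fun n hn => integral_indicator_one ((hE m hm).inter (hE n hn))
    rw [e1, e2]
    simp only [integral_const, probReal_univ, one_smul]
    nlinarith
  have hmarkov := mul_meas_ge_le_integral_of_nonneg
    (Eventually.of_forall fun y => sq_nonneg _) hint (L ^ 2 / 4)
  have hmono : μ.real {y | ∑ n ∈ s, (E n).indicator 1 y < L / 2} ≤
      μ.real {y | L ^ 2 / 4 ≤ (∑ n ∈ s, (E n).indicator (1 : Ω → ℝ) y - L) ^ 2} := by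
    refine measureReal_mono (fun y hy => ?_)
    simp only [Set.mem_ofPred_eq] at hy ⊢
    nlinarith
  rw [le_div_iff₀ hL]
  nlinarith

theorem sum_pow_le_of_injOn {r : ℝ} (h0 : 0 ≤ r) (h1 : r < 1) (t : Finset ℕ) {f : ℕ → ℕ}
    (hf : Set.InjOn f t) : ∑ m ∈ t, r ^ f m ≤ (1 - r)⁻¹ := by
  rw [← Finset.sum_image (f := fun k => r ^ k) hf, ← tsum_geometric_of_lt_one h0 h1]
  exact (summable_geometric_of_lt_one h0 h1).sum_le_tsum _ fun _ _ => by positivity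

theorem measurableSet_fract_mul_mem_Icc (u p q : ℝ) :
    MeasurableSet {y : ℝ | Int.fract (u * y) ∈ Set.Icc p q} :=
  (measurable_fract.comp (measurable_const_mul u)) measurableSet_Icc

theorem measureReal_sum_indicator_fract_lt_le {u : ℕ → ℝ} (hu : ∀ n, 0 < u n) (hu1 : 1 ≤ u 1)
    {c δ : ℝ} (hc : c ∈ Set.Ioo (0 : ℝ) 1) (hδ : 0 ≤ δ)
    (hsub : ∀ n : ℕ, 1 ≤ n → u (n + 1) / u n ≥ 1 + c * (n : ℝ) ^ (-δ))
    {p q : ℕ → ℝ} (hp : ∀ n, 1 ≤ n → 0 ≤ p n) (hpq : ∀ n, 1 ≤ n → p n ≤ q n)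
    (hq : ∀ n, 1 ≤ n → q n ≤ 1) {N : ℕ} (hN : 1 ≤ N) {s : Finset ℕ} (hs : s ⊆ Finset.Icc 1 N)
    (hL : 0 < ∑ n ∈ s, (q n - p n)) :
    (volume.restrict (Set.Icc (0 : ℝ) 1)).real
      {y | ∑ n ∈ s, {y : ℝ | Int.fract (u n * y) ∈ Set.Icc (p n) (q n)}.indicator 1 y <
        (∑ n ∈ s, (q n - p n)) / 2} ≤
      48 * (2 / c * (N : ℝ) ^ δ) / ∑ n ∈ s, (q n - p n) := by
  have hc0 := hc.1
  have hN0 : (0 : ℝ) < N := by exact_mod_cast hN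
  have hprob : IsProbabilityMeasure (volume.restrict (Set.Icc (0 : ℝ) 1)) := ⟨by simp⟩
  have hmeas := fun n => measurableSet_fract_mul_mem_Icc (u n) (p n) (q n)
  have hrestrict : ∀ S : Set ℝ, MeasurableSet S →
      (volume.restrict (Set.Icc (0 : ℝ) 1)).real S = volume.real (Set.Icc 0 1 ∩ S) := fun S hS => by
    rw [measureReal_restrict_apply hS, Set.inter_comm]
  have hmem : ∀ n ∈ s, 1 ≤ n ∧ n ≤ N := fun n hn => Finset.mem_Icc.mp (hs hn)
  have hℓ0 : ∀ n ∈ s, 0 ≤ q n - p n := fun n hn => by linarith [hpq n (hmem n hn).1]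
  have hℓ1 : ∀ n ∈ s, q n - p n ≤ 1 := fun n hn => by
    linarith [hq n (hmem n hn).1, hp n (hmem n hn).1]
  set G : ℝ := 2 / c * (N : ℝ) ^ δ with hG
  set b : ℝ := c * (N : ℝ) ^ (-δ) with hb
  have hb0 : 0 < b := by positivity
  have hb1 : b ≤ 1 := by
    have : (N : ℝ) ^ (-δ) ≤ 1 :=
      Real.rpow_le_one_of_one_le_of_nonpos (by exact_mod_cast hN) (by linarith)
    nlinarith [hc.2]
  set r : ℝ := (1 + b)⁻¹ with hr
  have hr0 : 0 < r := by positivity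
  have hr1 : r < 1 := inv_lt_one_of_one_lt₀ (by linarith)
  have hgeom : ∀ (t : Finset ℕ) (f : ℕ → ℕ), Set.InjOn f t → ∑ m ∈ t, r ^ f m ≤ G := by
    intro t f hf
    refine (sum_pow_le_of_injOn hr0.le hr1 t hf).trans ?_
    have h1 : (1 - r)⁻¹ = (1 + b) / b := by
      have : 1 - r = b / (1 + b) := by rw [hr]; field_simp; ring
      rw [this, inv_div]
    have h2 : G = 2 / b := by
      rw [hG, hb, Real.rpow_neg hN0.le]; field_simp
    rw [h1, h2]
    gcongr
    linarith
  have hgrow : ∀ m n : ℕ, 1 ≤ m → m ≤ n → n ≤ N → u m / u n ≤ r ^ (n - m) := by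
    intro m n hm hmn hnN
    have h := mul_pow_le_of_sublacunary hu hc0.le hδ hsub hm hmn hnN
    rw [hr, inv_pow, div_le_iff₀ (hu n), inv_mul_eq_div, le_div_iff₀ (by positivity)]
    exact h
  have hinv : ∀ n : ℕ, 1 ≤ n → n ≤ N → 1 / u n ≤ r ^ (n - 1) := fun n hn hnN =>
    (div_le_div_of_nonneg_right hu1 (hu n).le).trans (hgrow 1 n le_rfl hn hnN)
  have hone : ∀ n : ℕ, 1 ≤ n → n ≤ N → 1 ≤ u n := fun n hn hnN => by
    have h := (hinv n hn hnN).trans (pow_le_one₀ hr0.le hr1.le)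
    rwa [div_le_iff₀ (hu n), one_mul] at h
  refine measureReal_sum_indicator_lt_le s (fun n _ => hmeas n) hL ?_ ?_
  · have h1 : ∑ n ∈ s, (q n - p n) - ∑ n ∈ s, r ^ (n - 1) ≤
        ∑ n ∈ s, (volume.restrict (Set.Icc (0 : ℝ) 1)).real
          {y | Int.fract (u n * y) ∈ Set.Icc (p n) (q n)} := by
      rw [← Finset.sum_sub_distrib]
      refine Finset.sum_le_sum fun n hn => ?_
      obtain ⟨hn1, hnN⟩ := hmem n hn
      rw [hrestrict _ (hmeas n)]
      refine le_trans ?_ (le_volumeReal_Icc_inter_fract (hu n) (hp n hn1) (hpq n hn1) (hq n hn1))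
      nlinarith [hinv n hn1 hnN, hℓ0 n hn, hℓ1 n hn, one_div_pos.mpr (hu n)]
    have h2 := hgeom s (fun n => n - 1) (fun m hm n hn h => by
      have := hmem m hm; have := hmem n hn; simp only at h; omega)
    linarith
  · set g : ℕ → ℕ → ℝ := fun m n =>
      if m ≤ n then (q n - p n) * (r ^ (m - 1) + 4 * r ^ (n - m)) else 0 with hg
    have hg0 : ∀ m n, n ∈ s → 0 ≤ g m n := fun m n hn => by
      have := hℓ0 n hn
      simp only [hg]; split_ifs <;> positivity
    have hpair : ∀ m ∈ s, ∀ n ∈ s, m ≤ n → (volume.restrict (Set.Icc (0 : ℝ) 1)).real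
        ({y | Int.fract (u m * y) ∈ Set.Icc (p m) (q m)} ∩
          {y | Int.fract (u n * y) ∈ Set.Icc (p n) (q n)}) ≤
        (q m - p m) * (q n - p n) + g m n := by
      intro m hm n hn hmn
      obtain ⟨hm1, hmN⟩ := hmem m hm
      obtain ⟨hn1, hnN⟩ := hmem n hn
      rw [hrestrict _ ((hmeas m).inter (hmeas n))]
      refine (volumeReal_Icc_inter_fract_inter_fract_le (hu m) (hu n)
        (hpq m hm1) (hpq n hn1)).trans ?_
      have e : (u m + 1) * ((q n - p n) * ((q m - p m) / u m) + 2 * (q n - p n) / u n) =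
          (q m - p m) * (q n - p n) + (q n - p n) * ((q m - p m) * (1 / u m) +
            2 * (u m / u n) + 2 * (1 / u n)) := by
        have := hu m; have := hu n
        field_simp
        ring
      have hmu := hone m hm1 hmN
      have h1 : 1 / u n ≤ u m / u n := div_le_div_of_nonneg_right hmu (hu n).le
      have h2 : (q m - p m) * (1 / u m) ≤ 1 * (1 / u m) :=
        mul_le_mul_of_nonneg_right (hℓ1 m hm) (one_div_pos.mpr (hu m)).le
      rw [e, hg]
      simp only [hmn, if_true]
      refine add_le_add_right (mul_le_mul_of_nonneg_left ?_ (hℓ0 n hn)) _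
      linarith [hgrow m n hm1 hmn hnN, hinv m hm1 hmN]
    have hsum : ∑ n ∈ s, ∑ m ∈ s, g m n ≤ ∑ n ∈ s, (q n - p n) * (5 * G) := by
      refine Finset.sum_le_sum fun n hn => ?_
      simp only [hg]
      rw [← Finset.sum_filter, ← Finset.mul_sum, Finset.sum_add_distrib, ← Finset.mul_sum]
      have h1 := hgeom (s.filter (· ≤ n)) (fun m => m - 1) (fun m hm k hk h => by
        simp only [Finset.coe_filter, Set.mem_ofPred_eq] at hm hk h
        have := hmem m hm.1; have := hmem k hk.1; omega)
      have h2 := hgeom (s.filter (· ≤ n)) (fun m => n - m) (fun m hm k hk h => by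
        simp only [Finset.coe_filter, Set.mem_ofPred_eq] at hm hk h
        omega)
      exact mul_le_mul_of_nonneg_left (by linarith) (hℓ0 n hn)
    calc _ ≤ ∑ m ∈ s, ∑ n ∈ s, ((q m - p m) * (q n - p n) + g m n + g n m) := by
          refine Finset.sum_le_sum fun m hm => Finset.sum_le_sum fun n hn => ?_
          rcases le_total m n with h | h
          · linarith [hpair m hm n hn h, hg0 n m hm]
          · rw [Set.inter_comm]
            linarith [hpair n hn m hm h, hg0 m n hn]
      _ = (∑ n ∈ s, (q n - p n)) ^ 2 + ∑ n ∈ s, ∑ m ∈ s, g m n + ∑ n ∈ s, ∑ m ∈ s, g m n := by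
          simp only [Finset.sum_add_distrib]
          rw [sq, Finset.sum_mul_sum, Finset.sum_comm (f := fun m n => g m n)]
      _ ≤ _ := by
          rw [← Finset.sum_mul] at hsum
          linarith

theorem ae_frequently_notMem {Ω : Type*} [MeasurableSpace Ω] {μ : Measure Ω} [IsFiniteMeasure μ]
    {B : ℕ → Set Ω} {P : ℕ → Prop} (hP : ∃ᶠ N in atTop, P N) {g : ℕ → ℝ}
    (hg : Tendsto g atTop (nhds 0)) (hB : ∀ᶠ N in atTop, P N → μ.real (B N) ≤ g N) :
    ∀ᵐ y ∂μ, ∃ᶠ N in atTop, P N ∧ y ∉ B N := by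
  have key : ∀ M : ℕ, ∀ᵐ y ∂μ, ∃ N ≥ M, P N ∧ y ∉ B N := by
    intro M
    rw [ae_iff, ← measureReal_eq_zero_iff]
    by_contra h
    have hpos := lt_of_le_of_ne measureReal_nonneg (Ne.symm h)
    obtain ⟨N, hPN, ⟨hlt, hle⟩, hNM⟩ := (hP.and_eventually
      (((hg.eventually (gt_mem_nhds hpos)).and hB).and (eventually_ge_atTop M))).exists
    refine absurd (measureReal_mono (μ := μ) (fun y hy => ?_)) (not_le.mpr ((hle hPN).trans_lt hlt))
    simp only [Set.mem_ofPred_eq, not_exists, not_and, not_not] at hy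
    exact hy N hNM hPN
  filter_upwards [ae_all_iff.mpr key] with y hy
  exact frequently_atTop.mpr hy

theorem ncard_inter_Icc_le (A : Set ℕ) (N : ℕ) : (A ∩ Set.Icc 1 N).ncard ≤ N := by
  refine (Set.ncard_le_ncard Set.inter_subset_right (Set.finite_Icc 1 N)).trans ?_
  rw [← Finset.coe_Icc, Set.ncard_coe_finset, Nat.card_Icc]
  omega

theorem log_ncard_div_log_mem_Icc (A : Set ℕ) (N : ℕ) :
    Real.log ((A ∩ Set.Icc 1 N).ncard : ℝ) / Real.log N ∈ Set.Icc (0 : ℝ) 1 := by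
  refine ⟨div_nonneg (Real.log_natCast_nonneg _) (Real.log_natCast_nonneg _),
    div_le_one_of_le₀ ?_ (Real.log_natCast_nonneg _)⟩
  rcases Nat.eq_zero_or_pos (A ∩ Set.Icc 1 N).ncard with h | h
  · simp [h, Real.log_natCast_nonneg]
  · exact Real.log_le_log (by exact_mod_cast h) (by exact_mod_cast ncard_inter_Icc_le A N)

theorem isBoundedUnder_le_log_ncard_div_log (A : Set ℕ) : IsBoundedUnder (· ≤ ·) atTop
    (fun N : ℕ => Real.log ((A ∩ Set.Icc 1 N).ncard : ℝ) / Real.log N) :=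
  isBoundedUnder_of ⟨1, fun N => (log_ncard_div_log_mem_Icc A N).2⟩

theorem isCoboundedUnder_le_log_ncard_div_log (A : Set ℕ) : IsCoboundedUnder (· ≤ ·) atTop
    (fun N : ℕ => Real.log ((A ∩ Set.Icc 1 N).ncard : ℝ) / Real.log N) :=
  (isBoundedUnder_of (r := (· ≥ ·))
    ⟨0, fun N => (log_ncard_div_log_mem_Icc A N).1⟩).isCoboundedUnder_le

theorem tendsto_log_natCast_atTop : Tendsto (fun N : ℕ => Real.log N) atTop atTop :=
  Real.tendsto_log_atTop.comp tendsto_natCast_atTop_atTop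

theorem eventually_ncard_le_of_upperMassDim_lt {A : Set ℕ} {r : ℝ} (h : upperMassDim A < r) :
    ∀ᶠ N : ℕ in atTop, ((A ∩ Set.Icc 1 N).ncard : ℝ) ≤ (N : ℝ) ^ r := by
  filter_upwards [eventually_lt_of_limsup_lt h (isBoundedUnder_le_log_ncard_div_log A),
    eventually_ge_atTop 2] with N hN h2
  have hlog : 0 < Real.log N := Real.log_pos (by exact_mod_cast h2)
  rcases Nat.eq_zero_or_pos (A ∩ Set.Icc 1 N).ncard with h0 | h0
  · rw [h0, Nat.cast_zero]; positivity
  · rw [div_lt_iff₀ hlog] at hN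
    exact (Real.le_rpow_iff_log_le (by exact_mod_cast h0) (by positivity)).mpr hN.le

theorem frequently_le_ncard_of_lt_upperMassDim {A : Set ℕ} {r : ℝ} (hr : 0 ≤ r)
    (h : r < upperMassDim A) :
    ∃ᶠ N : ℕ in atTop, (N : ℝ) ^ r ≤ ((A ∩ Set.Icc 1 N).ncard : ℝ) := by
  refine ((frequently_lt_of_lt_limsup (isCoboundedUnder_le_log_ncard_div_log A) h).and_eventually
    (eventually_ge_atTop 2)).mono fun N ⟨hN, h2⟩ => ?_
  have hlog : 0 < Real.log N := Real.log_pos (by exact_mod_cast h2)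
  rw [lt_div_iff₀ hlog] at hN
  rcases Nat.eq_zero_or_pos (A ∩ Set.Icc 1 N).ncard with h0 | h0
  · rw [h0, Nat.cast_zero, Real.log_zero] at hN
    exact absurd hN (not_lt.mpr (mul_nonneg hr hlog.le))
  · exact (Real.rpow_le_iff_le_log (by positivity) (by exact_mod_cast h0)).mpr hN.le

theorem upperMassDim_le_of_ncard_le {A : Set ℕ} {r C : ℝ} (hr : 0 ≤ r)
    (h : ∀ᶠ N : ℕ in atTop, ((A ∩ Set.Icc 1 N).ncard : ℝ) ≤ C * (N : ℝ) ^ r) :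
    upperMassDim A ≤ r := by
  refine le_of_forall_pos_le_add fun e he => ?_
  refine limsup_le_of_le (isCoboundedUnder_le_log_ncard_div_log A) ?_
  filter_upwards [h, eventually_ge_atTop 2,
    tendsto_log_natCast_atTop.eventually_ge_atTop (Real.log C / e)] with N hN h2 hC
  have hlog : 0 < Real.log N := Real.log_pos (by exact_mod_cast h2)
  have hN0 : (0 : ℝ) < N := by positivity
  rw [div_le_iff₀ hlog]
  rcases Nat.eq_zero_or_pos (A ∩ Set.Icc 1 N).ncard with h0 | h0
  · rw [h0, Nat.cast_zero, Real.log_zero]; exact mul_nonneg (by linarith) hlog.le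
  · have h0' : (0 : ℝ) < (A ∩ Set.Icc 1 N).ncard := by exact_mod_cast h0
    have hC0 : 0 < C := pos_of_mul_pos_left (h0'.trans_le hN) (by positivity)
    have := Real.log_le_log h0' hN
    rw [Real.log_mul hC0.ne' (by positivity), Real.log_rpow hN0] at this
    rw [div_le_iff₀ he] at hC
    linarith

theorem le_upperMassDim_of_le_ncard {A : Set ℕ} {r C : ℝ} (hC : 0 < C)
    (h : ∃ᶠ N : ℕ in atTop, C * (N : ℝ) ^ r ≤ ((A ∩ Set.Icc 1 N).ncard : ℝ)) :
    r ≤ upperMassDim A := by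
  refine le_of_forall_pos_le_add fun e he => ?_
  rw [← sub_le_iff_le_add]
  refine le_limsup_of_frequently_le ?_ (isBoundedUnder_le_log_ncard_div_log A)
  refine (h.and_eventually ((eventually_ge_atTop 2).and
    (tendsto_log_natCast_atTop.eventually_ge_atTop (-Real.log C / e)))).mono
      fun N ⟨hN, h2, hCe⟩ => ?_
  have hlog : 0 < Real.log N := Real.log_pos (by exact_mod_cast h2)
  have hN0 : (0 : ℝ) < N := by positivity
  rw [le_div_iff₀ hlog]
  have := Real.log_le_log (by positivity) hN
  rw [Real.log_mul hC.ne' (by positivity), Real.log_rpow hN0] at this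
  rw [div_le_iff₀ he] at hCe
  linarith

theorem upperMassDim_nonneg (A : Set ℕ) : 0 ≤ upperMassDim A :=
  le_limsup_of_frequently_le
    (Eventually.of_forall fun N => (log_ncard_div_log_mem_Icc A N).1).frequently
    (isBoundedUnder_le_log_ncard_div_log A)

theorem ncard_inter_Icc_eq_card_filter (A : Set ℕ) [DecidablePred (· ∈ A)] (N : ℕ) :
    (A ∩ Set.Icc 1 N).ncard = ((Finset.Icc 1 N).filter (· ∈ A)).card := by
  rw [← Set.ncard_coe_finset]
  congr 1
  ext n
  simp only [Set.mem_inter_iff, Set.mem_Icc, Finset.coe_filter, Finset.mem_Icc, Set.mem_ofPred_eq]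
  exact and_comm

theorem summable_indicator_rpow_neg {A : Set ℕ} {t : ℝ} (h : upperMassDim A < t) :
    Summable (A.indicator fun n : ℕ => (n : ℝ) ^ (-t)) := by
  classical
  obtain ⟨r, hr, hrt⟩ := exists_between h
  have hr0 : 0 ≤ r := (upperMassDim_nonneg A).trans hr.le
  have hO : (fun n : ℕ => ∑ k ∈ Finset.Icc 1 n, A.indicator (1 : ℕ → ℝ) k) =O[atTop]
      fun n : ℕ => (n : ℝ) ^ r := by
    refine Asymptotics.IsBigO.of_bound 1 ?_
    filter_upwards [eventually_ncard_le_of_upperMassDim_lt hr] with n hn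
    have hsum : ∑ k ∈ Finset.Icc 1 n, A.indicator (1 : ℕ → ℝ) k = (A ∩ Set.Icc 1 n).ncard := by
      rw [ncard_inter_Icc_eq_card_filter, Finset.card_filter]
      push_cast
      exact Finset.sum_congr rfl fun k _ => by simp [Set.indicator_apply]
    rw [hsum, one_mul, Real.norm_of_nonneg (by positivity), Real.norm_of_nonneg (by positivity)]
    exact hn
  have hL := (LSeriesSummable_of_sum_norm_bigO_and_nonneg (s := (t : ℂ)) hO
    (fun n => Set.indicator_nonneg (fun _ _ => zero_le_one) n) hr0 (by simpa using hrt)).norm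
  refine hL.congr fun n => ?_
  rw [LSeries.norm_term_eq]
  rcases Nat.eq_zero_or_pos n with rfl | hn
  · simp [Set.indicator_apply, Real.zero_rpow (neg_ne_zero.mpr (hr0.trans_lt hrt).ne')]
  · by_cases hA : n ∈ A
    · simp [hn.ne', hA, Real.rpow_neg]
    · simp [hA]

theorem ae_upperMassDim_inter_le {Ω : Type*} [MeasurableSpace Ω] {μ : Measure Ω}
    [IsFiniteMeasure μ] {E : ℕ → Set Ω} (hE : ∀ n, MeasurableSet (E n)) {a K t : ℝ}
    (hμ : ∀ n, 1 ≤ n → μ.real (E n) ≤ K * (n : ℝ) ^ (-a)) {A : Set ℕ} (ht : 0 < t)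
    (h : upperMassDim A - a < t) :
    ∀ᵐ y ∂μ, upperMassDim (A ∩ {n | y ∈ E n}) ≤ t := by
  classical
  set w : ℕ → ℝ := A.indicator fun n => (n : ℝ) ^ (-t) with hw
  set F : ℕ → Ω → ENNReal := fun n y => ENNReal.ofReal (w n) * (E n).indicator 1 y with hF
  have hFm : ∀ n, Measurable (F n) := fun n => (measurable_one.indicator (hE n)).const_mul _
  have hsum : Summable fun n : ℕ => K * A.indicator (fun n : ℕ => (n : ℝ) ^ (-(t + a))) n :=
    (summable_indicator_rpow_neg (by linarith)).mul_left K
  have hle : ∀ n, ∫⁻ y, F n y ∂μ ≤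
      ENNReal.ofReal (K * A.indicator (fun n : ℕ => (n : ℝ) ^ (-(t + a))) n) := by
    intro n
    rw [hF, lintegral_const_mul _ (measurable_one.indicator (hE n)), lintegral_indicator_one (hE n)]
    by_cases hA : n ∈ A
    · rcases Nat.eq_zero_or_pos n with rfl | hn
      · simp [hw, hA, Real.zero_rpow (neg_ne_zero.mpr ht.ne')]
      · have hn0 : (0 : ℝ) < n := by exact_mod_cast hn
        have hw0 : 0 ≤ w n := Set.indicator_nonneg (fun _ _ => by positivity) n
        rw [← ofReal_measureReal, ← ENNReal.ofReal_mul hw0]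
        refine ENNReal.ofReal_le_ofReal ?_
        simp only [hw, hA, Set.indicator_of_mem]
        calc (n : ℝ) ^ (-t) * μ.real (E n) ≤ (n : ℝ) ^ (-t) * (K * (n : ℝ) ^ (-a)) := by
              gcongr; exact hμ n hn
          _ = K * ((n : ℝ) ^ (-t) * (n : ℝ) ^ (-a)) := by ring
          _ = _ := by rw [← Real.rpow_add hn0, neg_add]
    · simp [hw, hA]
  have hfin : ∫⁻ y, ∑' n, F n y ∂μ ≠ ⊤ := by
    rw [lintegral_tsum fun n => (hFm n).aemeasurable]
    exact ne_top_of_le_ne_top hsum.tsum_ofReal_ne_top (ENNReal.tsum_le_tsum hle)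
  filter_upwards [ae_lt_top (Measurable.tsum hFm) hfin] with y hy
  refine upperMassDim_le_of_ncard_le (C := (∑' n, F n y).toReal) ht.le ?_
  filter_upwards [eventually_ge_atTop 1] with N hN
  have hN0 : (0 : ℝ) < N := by exact_mod_cast hN
  rw [ncard_inter_Icc_eq_card_filter]
  set T := (Finset.Icc 1 N).filter (· ∈ A ∩ {n | y ∈ E n}) with hT
  have h1 : T.card * ENNReal.ofReal ((N : ℝ) ^ (-t)) ≤ ∑' n, F n y := by
    rw [← nsmul_eq_mul, ← Finset.sum_const]
    refine (Finset.sum_le_sum fun n hn => ?_).trans (ENNReal.sum_le_tsum T)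
    simp only [hT, Finset.mem_filter, Finset.mem_Icc, Set.mem_inter_iff, Set.mem_ofPred_eq] at hn
    obtain ⟨⟨hn1, hnN⟩, hnA, hnE⟩ := hn
    simp only [hF, hw, hnA, hnE, Set.indicator_of_mem, Pi.one_apply, mul_one]
    exact ENNReal.ofReal_le_ofReal (Real.rpow_le_rpow_of_nonpos (by exact_mod_cast hn1)
      (by exact_mod_cast hnN) (by linarith))
  have h2 := ENNReal.toReal_mono hy.ne h1
  rw [ENNReal.toReal_mul, ENNReal.toReal_natCast, ENNReal.toReal_ofReal (by positivity),
    Real.rpow_neg hN0.le, ← div_eq_mul_inv, div_le_iff₀ (by positivity)] at h2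
  exact h2

theorem ae_le_upperMassDim_inter_fract {u : ℕ → ℝ} (hu : ∀ n, 0 < u n) (hu1 : 1 ≤ u 1)
    {a c δ : ℝ} (ha : 0 ≤ a) (hc : c ∈ Set.Ioo (0 : ℝ) 1) (hδ : 0 ≤ δ)
    (hsub : ∀ n : ℕ, 1 ≤ n → u (n + 1) / u n ≥ 1 + c * (n : ℝ) ^ (-δ))
    {p q : ℕ → ℝ} (hp : ∀ n, 1 ≤ n → 0 ≤ p n) (hq : ∀ n, 1 ≤ n → q n ≤ 1)
    (hpq : ∀ n : ℕ, 1 ≤ n → q n - p n = (n : ℝ) ^ (-a)) {A : Set ℕ} {t : ℝ} (ht : δ + a < t)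
    (htA : t < upperMassDim A) :
    ∀ᵐ y ∂(volume.restrict (Set.Icc (0 : ℝ) 1)),
      t - a ≤ upperMassDim (A ∩ {n | Int.fract (u n * y) ∈ Set.Icc (p n) (q n)}) := by
  classical
  have hc0 := hc.1
  set E : ℕ → Set ℝ := fun n => {y | Int.fract (u n * y) ∈ Set.Icc (p n) (q n)} with hE
  set T : ℕ → Finset ℕ := fun N => (Finset.Icc 1 N).filter (· ∈ A) with hT
  set L : ℕ → ℝ := fun N => ∑ n ∈ T N, (q n - p n) with hL
  have hLle : ∀ N : ℕ, 1 ≤ N → (N : ℝ) ^ t ≤ ((A ∩ Set.Icc 1 N).ncard : ℝ) →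
      (N : ℝ) ^ (t - a) ≤ L N := by
    intro N hN h
    have hN0 : (0 : ℝ) < N := by exact_mod_cast hN
    calc (N : ℝ) ^ (t - a) = (N : ℝ) ^ t * (N : ℝ) ^ (-a) := by
          rw [← Real.rpow_add hN0, sub_eq_add_neg]
      _ ≤ (T N).card * (N : ℝ) ^ (-a) := by
          rw [ncard_inter_Icc_eq_card_filter] at h
          gcongr
      _ = ∑ _n ∈ T N, (N : ℝ) ^ (-a) := by rw [Finset.sum_const, nsmul_eq_mul]
      _ ≤ L N := by
          refine Finset.sum_le_sum fun n hn => ?_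
          simp only [hT, Finset.mem_filter, Finset.mem_Icc] at hn
          rw [hpq n hn.1.1]
          exact Real.rpow_le_rpow_of_nonpos (by exact_mod_cast hn.1.1)
            (by exact_mod_cast hn.1.2) (by linarith)
  have hfreq := ae_frequently_notMem (μ := volume.restrict (Set.Icc (0 : ℝ) 1))
    (B := fun N => {y | ∑ n ∈ T N, (E n).indicator 1 y < L N / 2})
    (g := fun N : ℕ => 96 / c * (N : ℝ) ^ (-(t - a - δ)))
    (frequently_le_ncard_of_lt_upperMassDim (by linarith) htA) (by
      simpa using ((tendsto_rpow_neg_atTop (by linarith : 0 < t - a - δ)).comp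
        tendsto_natCast_atTop_atTop).const_mul (96 / c)) (by
      filter_upwards [eventually_ge_atTop 1] with N hN h
      have hN0 : (0 : ℝ) < N := by exact_mod_cast hN
      have hlow := hLle N hN h
      have hLpos : 0 < L N := lt_of_lt_of_le (by positivity) hlow
      refine (measureReal_sum_indicator_fract_lt_le hu hu1 hc hδ hsub hp (fun n hn => ?_) hq hN
        (Finset.filter_subset _ _) hLpos).trans ?_
      · have : 0 ≤ (n : ℝ) ^ (-a) := by positivity
        linarith [hpq n hn]
      · calc 48 * (2 / c * (N : ℝ) ^ δ) / L N
            ≤ 48 * (2 / c * (N : ℝ) ^ δ) / (N : ℝ) ^ (t - a) := by gcongr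
          _ = 96 / c * ((N : ℝ) ^ δ / (N : ℝ) ^ (t - a)) := by ring
          _ = _ := by rw [← Real.rpow_sub hN0]; congr 2; ring)
  filter_upwards [hfreq] with y hy
  refine le_upperMassDim_of_le_ncard (C := 1 / 2) (by norm_num) ?_
  refine (hy.and_eventually (eventually_ge_atTop 1)).mono fun N ⟨⟨h1, h2⟩, hN⟩ => ?_
  have hlow := hLle N hN h1
  rw [not_lt] at h2
  have hcount : ∑ n ∈ T N, (E n).indicator (1 : ℝ → ℝ) y =
      ((A ∩ {n | y ∈ E n}) ∩ Set.Icc 1 N).ncard := by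
    rw [ncard_inter_Icc_eq_card_filter, Finset.card_filter]
    push_cast
    rw [hT, Finset.sum_filter]
    refine Finset.sum_congr rfl fun n _ => ?_
    by_cases hA : n ∈ A <;> by_cases hy : y ∈ E n <;> simp [hA, hy]
  rw [hcount] at h2
  have h3 : (1 : ℝ) / 2 * (N : ℝ) ^ (t - a) ≤ L N / 2 := by linarith
  exact h3.trans h2

/-- transversality, large dimension case: if `δ + a < dim̄_M(A)`
then for a.e. `y ∈ [0,1]`, `dim̄_M(A ∩ Λ_y) = dim̄_M(A) − a`, where
`Λ_y = {n : frac(u_n y) ∈ I_n}`. -/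
theorem transversality_large (a δ : ℝ) (ha : a ∈ Set.Ioo (0:ℝ) 1) (hδ : δ ∈ Set.Ico (0:ℝ) 1)
    (u : ℕ → ℝ) (hu : ∀ n, 0 < u n) (hu1 : 1 ≤ u 1)
    (c : ℝ) (hc : c ∈ Set.Ioo (0:ℝ) 1)
    (hsub : ∀ n : ℕ, 1 ≤ n → u (n + 1) / u n ≥ 1 + c * (n : ℝ) ^ (-δ))
    (I : ℕ → Set ℝ) (hIsub : ∀ n, I n ⊆ Set.Icc (0:ℝ) 1)
    (hIint : ∀ n : ℕ, 1 ≤ n → ∃ p q : ℝ, I n = Set.Icc p q)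
    (hIvol : ∀ n : ℕ, 1 ≤ n → volume (I n) = ENNReal.ofReal ((n:ℝ) ^ (-a)))
    (A : Set ℕ) (hA : δ + a < upperMassDim A) :
    ∀ᵐ y ∂(volume.restrict (Set.Icc (0:ℝ) 1)),
      upperMassDim (A ∩ {n : ℕ | Int.fract (u n * y) ∈ I n}) = upperMassDim A - a := by
  have hex : ∀ n : ℕ, ∃ pq : ℝ × ℝ, 1 ≤ n → I n = Set.Icc pq.1 pq.2 := fun n => by
    by_cases hn : 1 ≤ n
    · obtain ⟨p, q, h⟩ := hIint n hn
      exact ⟨(p, q), fun _ => h⟩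
    · exact ⟨(0, 0), fun h => absurd h hn⟩
  choose pq hpq using hex
  have hlen : ∀ n : ℕ, 1 ≤ n → (pq n).2 - (pq n).1 = (n : ℝ) ^ (-a) := by
    intro n hn
    have hn0 : (0 : ℝ) < n := by exact_mod_cast hn
    have h := hIvol n hn
    rw [hpq n hn, Real.volume_Icc] at h
    have hpos : 0 < (n : ℝ) ^ (-a) := by positivity
    have h0 : 0 < (pq n).2 - (pq n).1 := by
      rw [← ENNReal.ofReal_pos, h, ENNReal.ofReal_pos]
      exact hpos
    exact (ENNReal.ofReal_eq_ofReal_iff h0.le hpos.le).mp h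
  have hle : ∀ n : ℕ, 1 ≤ n → (pq n).1 ≤ (pq n).2 := fun n hn => by
    have : 0 ≤ (n : ℝ) ^ (-a) := by positivity
    linarith [hlen n hn]
  have hp : ∀ n, 1 ≤ n → 0 ≤ (pq n).1 := fun n hn =>
    (hIsub n (hpq n hn ▸ Set.left_mem_Icc.mpr (hle n hn))).1
  have hq : ∀ n, 1 ≤ n → (pq n).2 ≤ 1 := fun n hn =>
    (hIsub n (hpq n hn ▸ Set.right_mem_Icc.mpr (hle n hn))).2
  have hset : ∀ y : ℝ, upperMassDim (A ∩ {n : ℕ | Int.fract (u n * y) ∈ I n}) =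
      upperMassDim (A ∩ {n : ℕ | Int.fract (u n * y) ∈ Set.Icc (pq n).1 (pq n).2}) := by
    intro y
    unfold upperMassDim
    congr 1
    funext N
    congr 4
    ext n
    simp only [Set.mem_inter_iff, Set.mem_ofPred_eq]
    exact and_congr_left fun hn => by rw [hpq n hn.1]
  simp only [hset]
  have hone : ∀ n : ℕ, 1 ≤ n → 1 ≤ u n := by
    intro n hn
    have h := mul_pow_le_of_sublacunary hu hc.1.le hδ.1 hsub le_rfl hn le_rfl
    have h1 : 1 ≤ (1 + c * (n : ℝ) ^ (-δ)) ^ (n - 1) :=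
      one_le_pow₀ (le_add_of_nonneg_right (mul_nonneg hc.1.le (by positivity)))
    nlinarith
  have hmeas := fun n => measurableSet_fract_mul_mem_Icc (u n) (pq n).1 (pq n).2
  have hμ : ∀ n : ℕ, 1 ≤ n → (volume.restrict (Set.Icc (0 : ℝ) 1)).real
      {y | Int.fract (u n * y) ∈ Set.Icc (pq n).1 (pq n).2} ≤ 3 * (n : ℝ) ^ (-a) := by
    intro n hn
    rw [measureReal_restrict_apply (hmeas n), Set.inter_comm]
    refine (volumeReal_Icc_inter_fract_le (hu n) (hle n hn) zero_le_one).trans ?_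
    rw [hlen n hn]
    have : 2 * (n : ℝ) ^ (-a) / u n ≤ 2 * (n : ℝ) ^ (-a) :=
      div_le_self (by positivity) (hone n hn)
    linarith
  have hupper : ∀ k : ℕ, ∀ᵐ y ∂(volume.restrict (Set.Icc (0 : ℝ) 1)),
      upperMassDim (A ∩ {n : ℕ | Int.fract (u n * y) ∈ Set.Icc (pq n).1 (pq n).2}) ≤
        upperMassDim A - a + 1 / ((k : ℝ) + 1) := by
    intro k
    have hk : 0 < 1 / ((k : ℝ) + 1) := Nat.one_div_pos_of_nat
    exact ae_upperMassDim_inter_le hmeas hμ (by linarith [hδ.1]) (by linarith)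
  obtain ⟨t, -, htlt, htlim⟩ := exists_seq_strictMono_tendsto' hA
  have hlower : ∀ k : ℕ, ∀ᵐ y ∂(volume.restrict (Set.Icc (0 : ℝ) 1)),
      t k - a ≤
        upperMassDim (A ∩ {n : ℕ | Int.fract (u n * y) ∈ Set.Icc (pq n).1 (pq n).2}) := fun k =>
    ae_le_upperMassDim_inter_fract hu hu1 ha.1.le hc hδ.1 hsub hp hq hlen (htlt k).1 (htlt k).2
  filter_upwards [ae_all_iff.mpr hupper, ae_all_iff.mpr hlower] with y h1 h2
  have hlim : Tendsto (fun k : ℕ => upperMassDim A - a + 1 / ((k : ℝ) + 1)) atTop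
      (nhds (upperMassDim A - a)) := by
    simpa using tendsto_one_div_add_atTop_nhds_zero_nat.const_add (upperMassDim A - a)
  exact le_antisymm (ge_of_tendsto' hlim h1) (le_of_tendsto' (htlim.sub_const a) h2)
end

section
/- Let a ∈ (0,1), b > a, and α > 1. Then for Lebesgue almost every y ∈ [0,1], the set {n prime : ⟨α^{n^b} y⟩ < n^{-a}} has mass dimension equal to 1 − a, where ⟨x⟩ denotes the distance from x to the nearest integer. -/
open MeasureTheory Filter

/-- Distance from a real number to the nearest integer. -/
noncomputable def distNearestInt (x : ℝ) : ℝ := |x - (round x : ℝ)|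

/-- The `1`-periodic function equal to `1` on `[0, δ)` and to `0` on `[δ, 1)`. -/
noncomputable def fractIndicator (δ x : ℝ) : ℝ := if Int.fract x < δ then 1 else 0

lemma fractIndicator_nonneg (δ x : ℝ) : 0 ≤ fractIndicator δ x := by
  unfold fractIndicator; split_ifs <;> norm_num

lemma fractIndicator_le_one (δ x : ℝ) : fractIndicator δ x ≤ 1 := by
  unfold fractIndicator; split_ifs <;> norm_num

lemma abs_fractIndicator_le_one (δ x : ℝ) : |fractIndicator δ x| ≤ 1 :=
  abs_le.mpr ⟨by linarith [fractIndicator_nonneg δ x], fractIndicator_le_one δ x⟩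

lemma abs_fractIndicator_mul_le_one (δ x η y : ℝ) :
    |fractIndicator δ x * fractIndicator η y| ≤ 1 := by
  rw [abs_mul]
  exact mul_le_one₀ (abs_fractIndicator_le_one _ _) (abs_nonneg _) (abs_fractIndicator_le_one _ _)

lemma measurable_fractIndicator (δ : ℝ) : Measurable (fractIndicator δ) :=
  Measurable.ite (measurableSet_lt measurable_fract measurable_const)
    measurable_const measurable_const

lemma periodic_fractIndicator (δ : ℝ) : Function.Periodic (fractIndicator δ) 1 := fun x => by
  simp [fractIndicator]

lemma intervalIntegrable_of_measurable_of_abs_le {f : ℝ → ℝ} (hf : Measurable f) {C : ℝ}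
    (hC : ∀ x, |f x| ≤ C) (s t : ℝ) : IntervalIntegrable f volume s t :=
  (intervalIntegrable_const (c := C)).mono_fun hf.aestronglyMeasurable
    (Eventually.of_forall fun x => (hC x).trans (le_abs_self C))

lemma intervalIntegrable_fractIndicator (δ u c s t : ℝ) :
    IntervalIntegrable (fun x => fractIndicator δ (u * x + c)) volume s t :=
  intervalIntegrable_of_measurable_of_abs_le (C := 1)
    ((measurable_fractIndicator δ).comp (by fun_prop))
    (fun _ => abs_fractIndicator_le_one _ _) s t

/-- On a period starting at an integer, integrating against `fractIndicator δ` restricts the domain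
to the initial segment of length `δ`. -/
lemma integral_fractIndicator_mul {δ : ℝ} (h0 : 0 ≤ δ) (h1 : δ ≤ 1) {g : ℝ → ℝ}
    (hg : ∀ s t, IntervalIntegrable g volume s t) (j : ℤ) :
    ∫ x in (j : ℝ)..(j + 1), fractIndicator δ x * g x = ∫ x in (j : ℝ)..(j + δ), g x := by
  have fr : ∀ x : ℝ, (j : ℝ) ≤ x → x < j + 1 → Int.fract x = x - j := fun x hx hx' => by
    rw [Int.fract, Int.floor_eq_iff.mpr ⟨hx, hx'⟩]
  have ae1 : ∀ᵐ x : ℝ, x ≠ j + δ := by simp [ae_iff]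
  have ae2 : ∀ᵐ x : ℝ, x ≠ j + 1 := by simp [ae_iff]
  have e1 : ∀ᵐ x : ℝ, x ∈ Set.uIoc (j : ℝ) (j + δ) → g x = fractIndicator δ x * g x := by
    filter_upwards [ae1] with x hx hxm
    rw [Set.uIoc_of_le (by linarith)] at hxm
    have : x < j + δ := lt_of_le_of_ne hxm.2 hx
    rw [fractIndicator, fr x hxm.1.le (by linarith), if_pos (by linarith), one_mul]
  have e2 : ∀ᵐ x : ℝ, x ∈ Set.uIoc (j + δ : ℝ) (j + 1) → 0 = fractIndicator δ x * g x := by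
    filter_upwards [ae2] with x hx hxm
    rw [Set.uIoc_of_le (by linarith)] at hxm
    have : x < j + 1 := lt_of_le_of_ne hxm.2 hx
    rw [fractIndicator, fr x (by linarith [hxm.1]) this, if_neg (by linarith [hxm.1]), zero_mul]
  rw [← intervalIntegral.integral_add_adjacent_intervals (b := (j : ℝ) + δ),
    ← intervalIntegral.integral_congr_ae e1, ← intervalIntegral.integral_congr_ae e2]
  · simp
  · exact (hg _ _).congr_ae ((ae_restrict_iff' measurableSet_uIoc).mpr e1)
  · exact (intervalIntegrable_const (c := (0 : ℝ))).congr_ae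
      ((ae_restrict_iff' measurableSet_uIoc).mpr e2)

lemma integral_fractIndicator_add_int {δ : ℝ} (h0 : 0 ≤ δ) (h1 : δ ≤ 1) (s : ℝ) (k : ℤ) :
    ∫ x in s..(s + k), fractIndicator δ x = k * δ := by
  have hi : ∀ s t, IntervalIntegrable (fractIndicator δ) volume s t := fun s t => by
    simpa using intervalIntegrable_fractIndicator δ 1 0 s t
  have h := (periodic_fractIndicator δ).intervalIntegral_add_zsmul_eq k s hi
  have h' := integral_fractIndicator_mul h0 h1 (g := fun _ => 1)
    (fun _ _ => intervalIntegrable_const) 0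
  rw [(periodic_fractIndicator δ).intervalIntegral_add_eq s 0] at h
  simp at h h'
  rw [h, h']

lemma integral_fractIndicator_le {δ : ℝ} (h0 : 0 ≤ δ) (h1 : δ ≤ 1) {s t : ℝ} (hst : s ≤ t) :
    ∫ x in s..t, fractIndicator δ x ≤ δ * (t - s + 1) := by
  have hi : ∀ s t, IntervalIntegrable (fractIndicator δ) volume s t := fun s t => by
    simpa using intervalIntegrable_fractIndicator δ 1 0 s t
  have hc := Int.le_ceil (t - s)
  have := Int.ceil_lt_add_one (t - s)
  calc ∫ x in s..t, fractIndicator δ x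
      ≤ ∫ x in s..(s + ⌈t - s⌉), fractIndicator δ x :=
        intervalIntegral.integral_mono_interval le_rfl hst (by linarith)
          (Eventually.of_forall fun x => fractIndicator_nonneg δ x) (hi _ _)
    _ = ⌈t - s⌉ * δ := integral_fractIndicator_add_int h0 h1 s _
    _ ≤ δ * (t - s + 1) := by nlinarith

lemma le_integral_fractIndicator {δ : ℝ} (h0 : 0 ≤ δ) (h1 : δ ≤ 1) {s t : ℝ} (hst : s ≤ t) :
    δ * (t - s - 1) ≤ ∫ x in s..t, fractIndicator δ x := by
  have hi : ∀ s t, IntervalIntegrable (fractIndicator δ) volume s t := fun s t => by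
    simpa using intervalIntegrable_fractIndicator δ 1 0 s t
  have hc := Int.floor_le (t - s)
  have := Int.lt_floor_add_one (t - s)
  have h0' : (0 : ℝ) ≤ ⌊t - s⌋ := by exact_mod_cast Int.floor_nonneg.mpr (by linarith)
  calc δ * (t - s - 1) ≤ ⌊t - s⌋ * δ := by nlinarith
    _ = ∫ x in s..(s + ⌊t - s⌋), fractIndicator δ x :=
        (integral_fractIndicator_add_int h0 h1 s _).symm
    _ ≤ ∫ x in s..t, fractIndicator δ x :=
        intervalIntegral.integral_mono_interval le_rfl (by linarith) (by linarith)
          (Eventually.of_forall fun x => fractIndicator_nonneg δ x) (hi _ _)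

lemma integral_fractIndicator_mul_add_le {δ : ℝ} (h0 : 0 ≤ δ) (h1 : δ ≤ 1) {u : ℝ} (hu : 0 < u)
    (c : ℝ) {s t : ℝ} (hst : s ≤ t) :
    ∫ y in s..t, fractIndicator δ (u * y + c) ≤ δ * (t - s + 1 / u) := by
  rw [intervalIntegral.integral_comp_mul_add _ hu.ne', smul_eq_mul, inv_mul_le_iff₀ hu]
  refine (integral_fractIndicator_le h0 h1 (by nlinarith)).trans_eq ?_
  field_simp
  ring

lemma le_integral_fractIndicator_mul {δ : ℝ} (h0 : 0 ≤ δ) (h1 : δ ≤ 1) {u : ℝ} (hu : 0 < u) :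
    δ * (1 - 1 / u) ≤ ∫ y in (0 : ℝ)..1, fractIndicator δ (u * y) := by
  rw [intervalIntegral.integral_comp_mul_left _ hu.ne', smul_eq_mul, le_inv_mul_iff₀ hu]
  refine le_trans (le_of_eq ?_) (le_integral_fractIndicator h0 h1 (by nlinarith))
  field_simp
  ring

lemma integral_fractIndicator_mul_fractIndicator_le {δ η : ℝ} (hδ0 : 0 ≤ δ) (hδ1 : δ ≤ 1)
    (hη0 : 0 ≤ η) (hη1 : η ≤ 1) {u v : ℝ} (hu : 1 ≤ u) (huv : u ≤ v) :
    ∫ y in (0 : ℝ)..1, fractIndicator δ (u * y) * fractIndicator η (v * y)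
      ≤ η * (δ + δ / u + 2 * (u / v)) := by
  have hu0 : 0 < u := by linarith
  have hv0 : 0 < v := by linarith
  set g : ℝ → ℝ := fun x => fractIndicator η (v / u * x) with hg
  have hgi : ∀ s t, IntervalIntegrable g volume s t := fun s t => by
    simpa using intervalIntegrable_fractIndicator η (v / u) 0 s t
  have hpi : ∀ s t, IntervalIntegrable (fun x => fractIndicator δ x * g x) volume s t := fun s t =>
    intervalIntegrable_of_measurable_of_abs_le (C := 1)
      ((measurable_fractIndicator δ).mul ((measurable_fractIndicator η).comp (by fun_prop)))
      (fun _ => abs_fractIndicator_mul_le_one _ _ _ _) s t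
  have e : ∀ y, fractIndicator δ (u * y) * fractIndicator η (v * y)
      = (fun x => fractIndicator δ x * g x) (u * y) := fun y => by
    simp only [hg]; congr 2; field_simp
  simp_rw [e]
  rw [intervalIntegral.integral_comp_mul_left (fun x => fractIndicator δ x * g x) hu0.ne',
    smul_eq_mul, inv_mul_le_iff₀ hu0, mul_zero, mul_one]
  have hJ := Nat.le_ceil u
  have hJ' := Nat.ceil_lt_add_one hu0.le
  calc ∫ x in (0 : ℝ)..u, fractIndicator δ x * g x
      ≤ ∫ x in (0 : ℝ)..(⌈u⌉₊ : ℕ), fractIndicator δ x * g x :=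
        intervalIntegral.integral_mono_interval le_rfl hu0.le hJ
          (Eventually.of_forall fun x =>
            mul_nonneg (fractIndicator_nonneg _ _) (fractIndicator_nonneg _ _)) (hpi _ _)
    _ = ∑ j ∈ Finset.range ⌈u⌉₊,
          ∫ x in (j : ℝ)..((j + 1 : ℕ) : ℝ), fractIndicator δ x * g x := by
        rw [intervalIntegral.sum_integral_adjacent_intervals (fun _ _ => hpi _ _)]
        simp
    _ ≤ ∑ j ∈ Finset.range ⌈u⌉₊, η * (δ + u / v) := by
        refine Finset.sum_le_sum fun j _ => ?_
        have h := integral_fractIndicator_mul hδ0 hδ1 hgi (j : ℤ)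
        push_cast at h ⊢
        rw [h]
        have h2 := integral_fractIndicator_mul_add_le hη0 hη1 (u := v / u) (by positivity) 0
          (s := (j : ℝ)) (t := j + δ) (by linarith)
        simpa [hg] using h2
    _ = ⌈u⌉₊ * (η * (δ + u / v)) := by simp
    _ ≤ (u + 1) * (η * (δ + u / v)) := by gcongr
    _ ≤ u * (η * (δ + δ / u + 2 * (u / v))) := by
        have : (1 : ℝ) * (u / v) ≤ u * (u / v) := by gcongr
        have h3 : u * (η * (δ + δ / u + 2 * (u / v))) - (u + 1) * (η * (δ + u / v))
            = η * (u * (u / v) - 1 * (u / v)) := by field_simp; ring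
        nlinarith [mul_nonneg hη0 (sub_nonneg.mpr this)]

/-- Quasi-independence of two dilates of the centred indicators. -/
lemma integral_centered_fractIndicator_mul_le {δ η : ℝ} (hδ0 : 0 ≤ δ) (hδ1 : δ ≤ 1)
    (hη0 : 0 ≤ η) (hη1 : η ≤ 1) {u v : ℝ} (hu : 1 ≤ u) (huv : u ≤ v) :
    ∫ y in (0 : ℝ)..1, (fractIndicator δ (u * y) - δ) * (fractIndicator η (v * y) - η)
      ≤ η * (2 * (1 / u) + 3 * (u / v)) := by
  have hu0 : 0 < u := by linarith
  have hv0 : 0 < v := by linarith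
  have i1 : IntervalIntegrable (fun y => fractIndicator δ (u * y)) volume 0 1 := by
    simpa using intervalIntegrable_fractIndicator δ u 0 0 1
  have i2 : IntervalIntegrable (fun y => fractIndicator η (v * y)) volume 0 1 := by
    simpa using intervalIntegrable_fractIndicator η v 0 0 1
  have i3 : IntervalIntegrable (fun y => fractIndicator δ (u * y) * fractIndicator η (v * y))
      volume 0 1 :=
    intervalIntegrable_of_measurable_of_abs_le (C := 1)
      (((measurable_fractIndicator δ).comp (by fun_prop)).mul
        ((measurable_fractIndicator η).comp (by fun_prop)))
      (fun _ => abs_fractIndicator_mul_le_one _ _ _ _) 0 1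
  have e : ∀ y, (fractIndicator δ (u * y) - δ) * (fractIndicator η (v * y) - η)
      = fractIndicator δ (u * y) * fractIndicator η (v * y) - η * fractIndicator δ (u * y)
        - δ * fractIndicator η (v * y) + δ * η := fun y => by ring
  simp_rw [e]
  rw [intervalIntegral.integral_add ((i3.sub (i1.const_mul η)).sub (i2.const_mul δ))
      intervalIntegrable_const,
    intervalIntegral.integral_sub (i3.sub (i1.const_mul η)) (i2.const_mul δ),
    intervalIntegral.integral_sub i3 (i1.const_mul η), intervalIntegral.integral_const_mul,
    intervalIntegral.integral_const_mul, intervalIntegral.integral_const]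
  have b1 := integral_fractIndicator_mul_fractIndicator_le hδ0 hδ1 hη0 hη1 hu huv
  have b2 := mul_le_mul_of_nonneg_left (le_integral_fractIndicator_mul hδ0 hδ1 hu0) hη0
  have b3 := mul_le_mul_of_nonneg_left
    (le_integral_fractIndicator_mul hη0 hη1 hv0) hδ0
  have c1 : 1 / v ≤ u / v := by gcongr
  have c2 : δ / u ≤ 1 / u := by gcongr
  have c3 : δ * (1 / u) ≤ 1 / u := by rw [mul_one_div]; exact c2
  have c4 : δ * (1 / v) ≤ u / v :=
    (mul_le_of_le_one_left (by positivity) hδ1).trans c1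
  simp only [sub_zero, one_smul]
  nlinarith [mul_le_mul_of_nonneg_left c2 hη0, mul_le_mul_of_nonneg_left c3 hη0,
    mul_le_mul_of_nonneg_left c4 hη0]

lemma sum_rpow_neg_le {s : ℝ} (hs0 : 0 < s) (hs1 : s < 1) (n : ℕ) :
    ∑ i ∈ Finset.Icc 1 n, (i : ℝ) ^ (-s) ≤ (n : ℝ) ^ (1 - s) / (1 - s) := by
  have hs : 0 < 1 - s := by linarith
  induction n with
  | zero => simp [Real.zero_rpow hs.ne']
  | succ n ih =>
    rw [Finset.sum_Icc_succ_top (by omega)]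
    set x : ℝ := ((n + 1 : ℕ) : ℝ) with hx
    have hx1 : 1 ≤ x := by rw [hx]; push_cast; linarith [Nat.cast_nonneg (α := ℝ) n]
    have hx0 : 0 < x := by linarith
    have hn : (n : ℝ) = x * (1 + -(1 / x)) := by
      rw [hx]; push_cast; field_simp; ring
    have h1x : 1 / x ≤ 1 := by rw [div_le_one hx0]; exact hx1
    have hb := rpow_one_add_le_one_add_mul_self (s := -(1 / x)) (by linarith) hs.le
      (by linarith : 1 - s ≤ 1)
    have key : (n : ℝ) ^ (1 - s) ≤ x ^ (1 - s) - (1 - s) * x ^ (-s) := by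
      rw [hn, Real.mul_rpow hx0.le (by linarith)]
      calc x ^ (1 - s) * (1 + -(1 / x)) ^ (1 - s)
          ≤ x ^ (1 - s) * (1 + (1 - s) * -(1 / x)) := by gcongr
        _ = x ^ (1 - s) - (1 - s) * x ^ (-s) := by
          rw [show 1 - s = -s + 1 by ring, Real.rpow_add_one hx0.ne']
          field_simp
          ring
    rw [le_div_iff₀ hs] at ih ⊢
    linarith

/-- A lower bound for the growth of `n ^ b` in terms of a smaller exponent. -/
lemma mul_rpow_mul_sub_le_rpow_sub_rpow {β b : ℝ} (h0 : 0 < β) (h1 : β < 1) (hb : β ≤ b) {i n : ℕ}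
    (hi : 1 ≤ i) (hin : i ≤ n) :
    β * (n : ℝ) ^ (β - 1) * ((n : ℝ) - i) ≤ (n : ℝ) ^ b - (i : ℝ) ^ b := by
  have hi0 : (0 : ℝ) < i := by exact_mod_cast hi
  have hn1 : (1 : ℝ) ≤ n := by exact_mod_cast hi.trans hin
  have hn0 : (0 : ℝ) < n := by linarith
  have hin' : (i : ℝ) ≤ n := by exact_mod_cast hin
  set t : ℝ := i / n with ht
  have ht0 : 0 < t := by positivity
  have ht1 : t ≤ 1 := by rw [ht, div_le_one hn0]; exact hin'
  have hit : (i : ℝ) = n * t := by rw [ht]; field_simp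
  have hB := rpow_one_add_le_one_add_mul_self (s := t - 1) (by linarith) h0.le h1.le
  have htb : t ^ b ≤ 1 + β * (t - 1) :=
    (Real.rpow_le_rpow_of_exponent_ge ht0 ht1 hb).trans (by simpa using hB)
  have hnb : (n : ℝ) ^ β ≤ (n : ℝ) ^ b := Real.rpow_le_rpow_of_exponent_le hn1 hb
  calc β * (n : ℝ) ^ (β - 1) * ((n : ℝ) - i) = (n : ℝ) ^ β * (β * (1 - t)) := by
        rw [hit, Real.rpow_sub_one hn0.ne']; field_simp
    _ ≤ (n : ℝ) ^ b * (β * (1 - t)) := by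
        have : 0 ≤ β * (1 - t) := mul_nonneg h0.le (by linarith)
        gcongr
    _ ≤ (n : ℝ) ^ b * (1 - t ^ b) := by gcongr; linarith
    _ = (n : ℝ) ^ b - (i : ℝ) ^ b := by
        rw [hit, Real.mul_rpow hn0.le ht0.le]; ring

lemma sum_exp_neg_mul_le {x : ℝ} (hx : 0 < x) (n : ℕ) :
    ∑ k ∈ Finset.range n, Real.exp (-(x * k)) ≤ 1 + 1 / x := by
  have hr : Real.exp (-x) < 1 := by rw [Real.exp_lt_one_iff]; linarith
  have e : ∀ k : ℕ, Real.exp (-(x * k)) = Real.exp (-x) ^ k := fun k => by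
    rw [← Real.exp_nat_mul]; congr 1; ring
  simp_rw [e]
  calc ∑ k ∈ Finset.range n, Real.exp (-x) ^ k ≤ ∑' k : ℕ, Real.exp (-x) ^ k :=
        (summable_geometric_of_lt_one (Real.exp_pos _).le hr).sum_le_tsum _
          (fun _ _ => by positivity)
    _ = (1 - Real.exp (-x))⁻¹ := tsum_geometric_of_lt_one (Real.exp_pos _).le hr
    _ ≤ (x / (1 + x))⁻¹ := by
        apply inv_anti₀ (by positivity)
        have h : Real.exp (-x) ≤ (1 + x)⁻¹ := by
          rw [Real.exp_neg]
          exact inv_anti₀ (by positivity) (by linarith [Real.add_one_le_exp x])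
        have : x / (1 + x) = 1 - (1 + x)⁻¹ := by field_simp; ring
        linarith
    _ = 1 + 1 / x := by field_simp; ring

lemma one_le_rpow_rpow {α b : ℝ} (hα : 1 < α) (n : ℕ) : 1 ≤ α ^ ((n : ℝ) ^ b) :=
  Real.one_le_rpow hα.le (by positivity)

lemma rpow_rpow_mono {α b : ℝ} (hα : 1 < α) (hb : 0 ≤ b) {i n : ℕ} (h : i ≤ n) :
    α ^ ((i : ℝ) ^ b) ≤ α ^ ((n : ℝ) ^ b) := by
  gcongr
  exact hα.le

lemma exists_sum_correlation_le {α β b : ℝ} (hα : 1 < α) (h0 : 0 < β) (h1 : β < 1) (hb : β ≤ b) :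
    ∃ K : ℝ, 0 < K ∧ ∀ n : ℕ, 1 ≤ n →
      ∑ i ∈ Finset.Icc 1 n, (2 * (1 / α ^ ((i : ℝ) ^ b))
        + 3 * (α ^ ((i : ℝ) ^ b) / α ^ ((n : ℝ) ^ b))) ≤ K * (n : ℝ) ^ (1 - β) := by
  have hα0 : 0 < α := by linarith
  have hc : 0 < Real.log α := Real.log_pos hα
  have hβ : 0 < 1 - β := by linarith
  set c := Real.log α
  refine ⟨2 * (1 / (c * (1 - β))) + 3 * (1 + 1 / (c * β)), by positivity, fun n hn => ?_⟩
  have hn1 : (1 : ℝ) ≤ n := by exact_mod_cast hn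
  have hn0 : (0 : ℝ) < n := by linarith
  have hA : ∑ i ∈ Finset.Icc 1 n, 1 / α ^ ((i : ℝ) ^ b) ≤ 1 / (c * (1 - β)) * (n : ℝ) ^ (1 - β) :=
    calc ∑ i ∈ Finset.Icc 1 n, 1 / α ^ ((i : ℝ) ^ b)
        ≤ ∑ i ∈ Finset.Icc 1 n, 1 / c * (i : ℝ) ^ (-β) := by
          refine Finset.sum_le_sum fun i hi => ?_
          have hi1 : (1 : ℝ) ≤ i := by exact_mod_cast (Finset.mem_Icc.mp hi).1
          have hi0 : (0 : ℝ) < i := by linarith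
          rw [Real.rpow_neg hi0.le, ← one_div, div_mul_div_comm, one_mul]
          apply one_div_le_one_div_of_le (by positivity)
          have h2 : (i : ℝ) ^ β ≤ (i : ℝ) ^ b := Real.rpow_le_rpow_of_exponent_le hi1 hb
          rw [Real.rpow_def_of_pos hα0]
          have := Real.add_one_le_exp (Real.log α * (i : ℝ) ^ b)
          have h3 : c * (i : ℝ) ^ β ≤ c * (i : ℝ) ^ b := by gcongr
          linarith
      _ = 1 / c * ∑ i ∈ Finset.Icc 1 n, (i : ℝ) ^ (-β) := by rw [Finset.mul_sum]
      _ ≤ 1 / c * ((n : ℝ) ^ (1 - β) / (1 - β)) := by gcongr; exact sum_rpow_neg_le h0 h1 n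
      _ = 1 / (c * (1 - β)) * (n : ℝ) ^ (1 - β) := by field_simp
  have hB : ∑ i ∈ Finset.Icc 1 n, α ^ ((i : ℝ) ^ b) / α ^ ((n : ℝ) ^ b)
      ≤ (1 + 1 / (c * β)) * (n : ℝ) ^ (1 - β) := by
    set x : ℝ := c * (β * (n : ℝ) ^ (β - 1)) with hx
    have hx0 : 0 < x := by positivity
    have hp : (1 : ℝ) ≤ (n : ℝ) ^ (1 - β) := Real.one_le_rpow hn1 hβ.le
    calc ∑ i ∈ Finset.Icc 1 n, α ^ ((i : ℝ) ^ b) / α ^ ((n : ℝ) ^ b)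
        ≤ ∑ i ∈ Finset.Icc 1 n, Real.exp (-(x * ((n - i : ℕ) : ℝ))) := by
          refine Finset.sum_le_sum fun i hi => ?_
          obtain ⟨hi1, hin⟩ := Finset.mem_Icc.mp hi
          rw [← Real.rpow_sub hα0, Real.rpow_def_of_pos hα0, Nat.cast_sub hin]
          apply Real.exp_le_exp.mpr
          have := mul_le_mul_of_nonneg_left
            (mul_rpow_mul_sub_le_rpow_sub_rpow h0 h1 hb hi1 hin) hc.le
          rw [hx]
          linarith
      _ = ∑ k ∈ Finset.range n, Real.exp (-(x * k)) :=
          Finset.sum_nbij' (fun i => n - i) (fun k => n - k)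
            (fun i hi => by simp at hi ⊢; omega) (fun k hk => by simp at hk ⊢; omega)
            (fun i hi => by simp at hi ⊢; omega) (fun k hk => by simp at hk ⊢; omega)
            (fun i _ => rfl)
      _ ≤ 1 + 1 / x := sum_exp_neg_mul_le hx0 n
      _ = 1 + 1 / (c * β) * (n : ℝ) ^ (1 - β) := by
          rw [hx, show 1 - β = -(β - 1) by ring, Real.rpow_neg hn0.le]
          field_simp
      _ ≤ (1 + 1 / (c * β)) * (n : ℝ) ^ (1 - β) := by nlinarith
  rw [Finset.sum_add_distrib, ← Finset.mul_sum, ← Finset.mul_sum]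
  linarith

/-- Chebyshev's lower bound for the prime counting function along powers of two. -/
lemma eventually_rpow_le_primeCounting_two_pow {ε : ℝ} (hε : 0 < ε) :
    ∀ᶠ k : ℕ in atTop, 2 * ((2 : ℝ) ^ k) ^ (1 - ε) ≤ Nat.primeCounting (2 ^ k) := by
  have h1 : Tendsto (fun k : ℕ => (k : ℝ) * ((2 : ℝ) ^ (-ε)) ^ k) atTop (nhds 0) :=
    tendsto_self_mul_const_pow_of_lt_one (by positivity)
      (Real.rpow_lt_one_of_one_lt_of_neg (by norm_num) (by linarith))
  have h2 : Tendsto (fun k : ℕ => (k : ℝ) * ((1 : ℝ) / 2) ^ k) atTop (nhds 0) :=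
    tendsto_self_mul_const_pow_of_lt_one (by norm_num) (by norm_num)
  filter_upwards [h1.eventually_le_const (show (0 : ℝ) < 1 / 4 by norm_num),
    h2.eventually_le_const (show (0 : ℝ) < 1 / 4 by norm_num), eventually_ge_atTop 1]
    with k hk1 hk2 hk
  have hk0 : (0 : ℝ) < k := by exact_mod_cast hk
  have hl2 : 0 < Real.log 2 := Real.log_pos (by norm_num)
  have hpi := Chebyshev.pi_ge (2 ^ k)
  push_cast at hpi
  rw [Real.log_pow] at hpi
  have h2k : (1 : ℝ) ≤ 2 ^ k := one_le_pow₀ (by norm_num)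
  have hlog : Real.log ((2 : ℝ) ^ k + 1) ≤ 2 * k * Real.log 2 := by
    have h3 : ((2 : ℝ) ^ k + 1) ≤ 2 ^ (k + 1) := by rw [pow_succ]; linarith
    have := Real.log_le_log (by positivity) h3
    rw [Real.log_pow] at this
    push_cast at this
    have hk1 : (1 : ℝ) ≤ k := by exact_mod_cast hk
    nlinarith
  have h4 : (2 : ℝ) ^ k / k - 2 ≤ Nat.primeCounting (2 ^ k) := by
    refine le_trans ?_ hpi
    rw [le_div_iff₀ (by positivity)]
    have : ((2 : ℝ) ^ k / k - 2) * (k * Real.log 2) = 2 ^ k * Real.log 2 - 2 * k * Real.log 2 := by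
      field_simp
    linarith
  refine le_trans ?_ h4
  have h5 : ((2 : ℝ) ^ k) ^ (1 - ε) = 2 ^ k * ((2 : ℝ) ^ (-ε)) ^ k := by
    rw [sub_eq_add_neg, Real.rpow_add (by positivity), Real.rpow_one, ← Real.rpow_natCast,
      ← Real.rpow_natCast, ← Real.rpow_mul (by norm_num), ← Real.rpow_mul (by norm_num)]
    ring_nf
  rw [h5]
  have h6 : (2 : ℝ) ^ k * ((2 : ℝ) ^ (-ε)) ^ k ≤ 2 ^ k / k * (1 / 4) := by
    have : (2 : ℝ) ^ k * ((2 : ℝ) ^ (-ε)) ^ k = 2 ^ k / k * (k * ((2 : ℝ) ^ (-ε)) ^ k) := by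
      field_simp
    rw [this]
    gcongr
  have h7 : 4 ≤ (2 : ℝ) ^ k / k := by
    rw [le_div_iff₀ hk0]
    rw [one_div, inv_pow, ← div_eq_mul_inv, div_le_iff₀ (by positivity)] at hk2
    linarith
  linarith

lemma ae_eventually_lt_one_of_summable_integral {f : ℕ → ℝ → ℝ} (hf : ∀ k y, 0 ≤ f k y)
    (hi : ∀ k, IntervalIntegrable (f k) volume 0 1)
    (hs : Summable fun k => ∫ y in (0 : ℝ)..1, f k y) :
    ∀ᵐ y ∂(volume.restrict (Set.Icc (0 : ℝ) 1)), ∀ᶠ k in atTop, f k y < 1 := by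
  have he : ∀ k, ∫ y in (0 : ℝ)..1, f k y = ∫ y in Set.Icc (0 : ℝ) 1, f k y := fun k => by
    rw [intervalIntegral.integral_of_le zero_le_one, integral_Icc_eq_integral_Ioc]
  have hle : ∀ k, volume.restrict (Set.Icc (0 : ℝ) 1) {y | 1 ≤ f k y}
      ≤ ENNReal.ofReal (∫ y in (0 : ℝ)..1, f k y) := fun k => by
    have h := mul_meas_ge_le_integral_of_nonneg (μ := volume.restrict (Set.Icc (0 : ℝ) 1))
      (Eventually.of_forall (hf k))
      ((intervalIntegrable_iff_integrableOn_Icc_of_le zero_le_one).mp (hi k)) 1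
    rw [one_mul, ← he] at h
    exact (ENNReal.le_ofReal_iff_toReal_le (measure_ne_top _ _)
      ((measureReal_nonneg).trans h)).mpr h
  have hsum : ∑' k, volume.restrict (Set.Icc (0 : ℝ) 1) {y | 1 ≤ f k y} ≠ ⊤ :=
    ne_top_of_le_ne_top hs.tsum_ofReal_ne_top (ENNReal.tsum_le_tsum hle)
  filter_upwards [ae_eventually_notMem hsum] with y hy
  filter_upwards [hy] with k hk
  simpa using hk

lemma rpow_neg_nat_le_one {a : ℝ} (ha : 0 ≤ a) (n : ℕ) : (n : ℝ) ^ (-a) ≤ 1 := by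
  rcases n.eq_zero_or_pos with rfl | hn
  · rcases ha.eq_or_lt with rfl | h
    · simp
    · rw [Nat.cast_zero, Real.zero_rpow (by linarith)]; exact zero_le_one
  · exact Real.rpow_le_one_of_one_le_of_nonpos (by exact_mod_cast hn) (by linarith)

/-- Second moment bound for the number of hits indexed by a subset of `{1, …, N}`. -/
lemma exists_integral_sq_sum_le {a b β α : ℝ} (ha0 : 0 < a) (ha1 : a < 1) (h0 : 0 < β) (h1 : β < 1)
    (hb : β ≤ b) (hα : 1 < α) :
    ∃ C : ℝ, 0 < C ∧ ∀ (N : ℕ) (S : Finset ℕ), S ⊆ Finset.Icc 1 N →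
      ∫ y in (0 : ℝ)..1, (∑ n ∈ S, (fractIndicator ((n : ℝ) ^ (-a)) (α ^ ((n : ℝ) ^ b) * y)
        - (n : ℝ) ^ (-a))) ^ 2 ≤ C * (N : ℝ) ^ (2 - a - β) := by
  obtain ⟨K, hK, hKb⟩ := exists_sum_correlation_le hα h0 h1 hb
  have hs : 0 < 1 - a := by linarith
  refine ⟨2 * K / (1 - a), by positivity, fun N S hS => ?_⟩
  set u : ℕ → ℝ := fun n => α ^ ((n : ℝ) ^ b) with hu
  set δ : ℕ → ℝ := fun n => (n : ℝ) ^ (-a) with hδ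
  have hu1 : ∀ n, 1 ≤ u n := fun n => one_le_rpow_rpow hα n
  have hu0 : ∀ n, 0 < u n := fun n => zero_lt_one.trans_le (hu1 n)
  have hδ0 : ∀ n, 0 ≤ δ n := fun n => by positivity
  have hδ1 : ∀ n, δ n ≤ 1 := fun n => rpow_neg_nat_le_one ha0.le n
  set g : ℕ → ℝ → ℝ := fun n y => fractIndicator (δ n) (u n * y) - δ n with hg
  set B : ℕ → ℕ → ℝ := fun i j => δ j * (2 * (1 / u i) + 3 * (u i / u j))
  have hB0 : ∀ i j, 0 ≤ B i j := fun i j => by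
    have := hu0 i; have := hu0 j; have := hδ0 j
    positivity
  have hgi : ∀ i j, IntervalIntegrable (fun y => g i y * g j y) volume 0 1 := fun i j => by
    have hm : ∀ n, Measurable (g n) := fun n =>
      ((measurable_fractIndicator _).comp (by fun_prop)).sub_const _
    have hb : ∀ n y, |g n y| ≤ 1 := fun n y => by
      have := fractIndicator_nonneg (δ n) (u n * y)
      have := fractIndicator_le_one (δ n) (u n * y)
      exact abs_le.mpr ⟨by linarith [hδ1 n], by linarith [hδ0 n]⟩
    refine intervalIntegrable_of_measurable_of_abs_le (C := 1) ((hm i).mul (hm j)) (fun y => ?_) 0 1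
    change |g i y * g j y| ≤ 1
    rw [abs_mul]
    exact mul_le_one₀ (hb _ _) (abs_nonneg _) (hb _ _)
  have hG : ∀ i j, i ≤ j → ∫ y in (0 : ℝ)..1, g i y * g j y ≤ B i j := fun i j hij =>
    integral_centered_fractIndicator_mul_le (hδ0 i) (hδ1 i) (hδ0 j) (hδ1 j) (hu1 i)
      (rpow_rpow_mono hα (h0.le.trans hb) hij)
  have hG' : ∀ i j, ∫ y in (0 : ℝ)..1, g i y * g j y
      ≤ (if i ≤ j then B i j else 0) + (if j ≤ i then B j i else 0) := fun i j => by
    rcases le_total i j with hij | hij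
    · rw [if_pos hij]
      refine (hG i j hij).trans (le_add_of_nonneg_right ?_)
      split_ifs
      exacts [hB0 _ _, le_rfl]
    · rw [if_pos hij]
      simp_rw [mul_comm (g i _)]
      refine (hG j i hij).trans (le_add_of_nonneg_left ?_)
      split_ifs
      exacts [hB0 _ _, le_rfl]
  have hin : ∀ j ∈ S, ∑ i ∈ S, (if i ≤ j then B i j else 0)
      ≤ δ j * (K * (N : ℝ) ^ (1 - β)) := fun j hj => by
    obtain ⟨hj1, hjN⟩ := Finset.mem_Icc.mp (hS hj)
    rw [← Finset.sum_filter]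
    calc ∑ i ∈ S with i ≤ j, B i j ≤ ∑ i ∈ Finset.Icc 1 j, B i j :=
          Finset.sum_le_sum_of_subset_of_nonneg (fun i hi => by
            obtain ⟨hiS, hij⟩ := Finset.mem_filter.mp hi
            exact Finset.mem_Icc.mpr ⟨(Finset.mem_Icc.mp (hS hiS)).1, hij⟩)
            (fun _ _ _ => hB0 _ _)
      _ = δ j * ∑ i ∈ Finset.Icc 1 j, (2 * (1 / u i) + 3 * (u i / u j)) := by
          rw [Finset.mul_sum]
      _ ≤ δ j * (K * (j : ℝ) ^ (1 - β)) := mul_le_mul_of_nonneg_left (hKb j hj1) (hδ0 j)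
      _ ≤ δ j * (K * (N : ℝ) ^ (1 - β)) := by
          have := hδ0 j
          have : (0 : ℝ) ≤ 1 - β := by linarith
          gcongr
  have hδS : ∑ j ∈ S, δ j ≤ (N : ℝ) ^ (1 - a) / (1 - a) :=
    (Finset.sum_le_sum_of_subset_of_nonneg hS fun _ _ _ => hδ0 _).trans
      (sum_rpow_neg_le ha0 ha1 N)
  have hN : (N : ℝ) ^ (1 - a) * (N : ℝ) ^ (1 - β) = (N : ℝ) ^ (2 - a - β) := by
    rw [← Real.rpow_add_of_nonneg (Nat.cast_nonneg N) hs.le (by linarith)]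
    congr 1; ring
  calc ∫ y in (0 : ℝ)..1, (∑ n ∈ S, g n y) ^ 2
      = ∑ i ∈ S, ∑ j ∈ S, ∫ y in (0 : ℝ)..1, g i y * g j y := by
        simp_rw [sq, Finset.sum_mul_sum]
        rw [intervalIntegral.integral_finsetSum (fun i _ => by
          simpa only [Finset.sum_fn] using IntervalIntegrable.sum S fun j _ => hgi i j)]
        refine Finset.sum_congr rfl fun i _ => ?_
        rw [intervalIntegral.integral_finsetSum (fun j _ => hgi i j)]
    _ ≤ ∑ i ∈ S, ∑ j ∈ S, ((if i ≤ j then B i j else 0) + (if j ≤ i then B j i else 0)) :=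
        Finset.sum_le_sum fun i _ => Finset.sum_le_sum fun j _ => hG' i j
    _ = 2 * ∑ j ∈ S, ∑ i ∈ S, (if i ≤ j then B i j else 0) := by
        simp_rw [Finset.sum_add_distrib]
        rw [Finset.sum_comm, two_mul]
    _ ≤ 2 * ∑ j ∈ S, δ j * (K * (N : ℝ) ^ (1 - β)) := by
        gcongr with j hj
        exact hin j hj
    _ = 2 * ((∑ j ∈ S, δ j) * (K * (N : ℝ) ^ (1 - β))) := by rw [Finset.sum_mul]
    _ ≤ 2 * ((N : ℝ) ^ (1 - a) / (1 - a) * (K * (N : ℝ) ^ (1 - β))) := by gcongr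
    _ = 2 * K / (1 - a) * (N : ℝ) ^ (2 - a - β) := by rw [← hN]; ring

lemma summable_two_pow_rpow {s : ℝ} (hs : s < 0) : Summable fun k : ℕ => ((2 : ℝ) ^ k) ^ s := by
  have e : ∀ k : ℕ, ((2 : ℝ) ^ k) ^ s = ((2 : ℝ) ^ s) ^ k := fun k => by
    rw [← Real.rpow_natCast, ← Real.rpow_natCast, ← Real.rpow_mul (by norm_num),
      ← Real.rpow_mul (by norm_num), mul_comm]
  simp_rw [e]
  exact summable_geometric_of_lt_one (by positivity)
    (Real.rpow_lt_one_of_one_lt_of_neg (by norm_num) hs)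

lemma ae_eventually_rpow_le_sum {a b β α ε : ℝ} (ha0 : 0 < a) (ha1 : a < 1) (h0 : 0 < β)
    (h1 : β < 1) (hb : β ≤ b) (hα : 1 < α) (hε : 0 < ε) (hε' : 2 * ε < β - a) :
    ∀ᵐ y ∂(volume.restrict (Set.Icc (0 : ℝ) 1)), ∀ᶠ k : ℕ in atTop,
      ((2 : ℝ) ^ k) ^ (1 - a - ε) ≤ ∑ n ∈ Nat.primesLE (2 ^ k),
        fractIndicator ((n : ℝ) ^ (-a)) (α ^ ((n : ℝ) ^ b) * y) := by
  obtain ⟨C, hC, hCb⟩ := exists_integral_sq_sum_le ha0 ha1 h0 h1 hb hα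
  set g : ℕ → ℝ → ℝ := fun k y => ∑ n ∈ Nat.primesLE (2 ^ k),
    (fractIndicator ((n : ℝ) ^ (-a)) (α ^ ((n : ℝ) ^ b) * y) - (n : ℝ) ^ (-a)) with hg
  set T : ℕ → ℝ := fun k => ((2 : ℝ) ^ k) ^ (1 - a - ε) with hT
  have hT0 : ∀ k, 0 < T k := fun k => by positivity
  have hsub : ∀ N : ℕ, Nat.primesLE N ⊆ Finset.Icc 1 N := fun N p hp =>
    Finset.mem_Icc.mpr ⟨(Nat.prime_of_mem_primesLE hp).one_le, Nat.le_of_mem_primesLE hp⟩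
  have hgm : ∀ k, Measurable (g k) := fun k => Finset.measurable_sum _ fun n _ =>
    ((measurable_fractIndicator _).comp (by fun_prop)).sub_const _
  have hgb : ∀ k y, |g k y| ≤ (Nat.primesLE (2 ^ k)).card := fun k y => by
    refine (Finset.abs_sum_le_sum_abs _ _).trans ?_
    rw [← nsmul_one]
    refine Finset.sum_le_card_nsmul _ _ _ fun n _ => ?_
    have := fractIndicator_nonneg ((n : ℝ) ^ (-a)) (α ^ ((n : ℝ) ^ b) * y)
    have := fractIndicator_le_one ((n : ℝ) ^ (-a)) (α ^ ((n : ℝ) ^ b) * y)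
    have := rpow_neg_nat_le_one ha0.le n
    have : 0 ≤ (n : ℝ) ^ (-a) := by positivity
    exact abs_le.mpr ⟨by linarith, by linarith⟩
  have hgi : ∀ k, IntervalIntegrable (fun y => (g k y) ^ 2) volume 0 1 := fun k =>
    intervalIntegrable_of_measurable_of_abs_le (C := ((Nat.primesLE (2 ^ k)).card : ℝ) ^ 2)
      ((hgm k).pow_const 2) (fun y => by
        rw [abs_pow]
        exact pow_le_pow_left₀ (abs_nonneg _) (hgb k y) 2) 0 1
  have key := ae_eventually_lt_one_of_summable_integral
    (f := fun k y => (T k)⁻¹ ^ 2 * (g k y) ^ 2) (fun k y => by positivity)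
    (fun k => (hgi k).const_mul _) (by
      refine Summable.of_nonneg_of_le (fun k => ?_) (fun k => ?_)
        ((summable_two_pow_rpow (s := a - β + 2 * ε) (by linarith)).mul_left C)
      · exact intervalIntegral.integral_nonneg zero_le_one fun y _ => by positivity
      · rw [intervalIntegral.integral_const_mul]
        have h := hCb (2 ^ k) _ (hsub _)
        push_cast at h
        calc (T k)⁻¹ ^ 2 * ∫ y in (0 : ℝ)..1, (g k y) ^ 2
            ≤ (T k)⁻¹ ^ 2 * (C * ((2 : ℝ) ^ k) ^ (2 - a - β)) := by gcongr
          _ = C * ((2 : ℝ) ^ k) ^ (a - β + 2 * ε) := by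
            rw [hT]
            simp only
            rw [← Real.rpow_neg (by positivity), ← Real.rpow_mul_natCast (by positivity),
              mul_left_comm, ← Real.rpow_add (by positivity)]
            congr 2
            push_cast
            ring)
  filter_upwards [key] with y hy
  filter_upwards [hy, eventually_rpow_le_primeCounting_two_pow hε] with k hk hpi
  have hM : 2 * T k ≤ ∑ n ∈ Nat.primesLE (2 ^ k), (n : ℝ) ^ (-a) :=
    calc 2 * T k = 2 * ((2 : ℝ) ^ k) ^ (1 - ε) * ((2 : ℝ) ^ k) ^ (-a) := by
          rw [mul_assoc, ← Real.rpow_add (by positivity), hT]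
          simp only
          ring_nf
      _ ≤ Nat.primeCounting (2 ^ k) * ((2 : ℝ) ^ k) ^ (-a) := by gcongr
      _ = (Nat.primesLE (2 ^ k)).card • ((2 : ℝ) ^ k) ^ (-a) := by
          rw [Nat.primesLE_card_eq_primeCounting, nsmul_eq_mul]
      _ ≤ ∑ n ∈ Nat.primesLE (2 ^ k), (n : ℝ) ^ (-a) := by
          refine Finset.card_nsmul_le_sum _ _ _ fun n hn => ?_
          have hn0 : (0 : ℝ) < n := by exact_mod_cast (Nat.prime_of_mem_primesLE hn).pos
          exact Real.rpow_le_rpow_of_nonpos hn0 (by exact_mod_cast Nat.le_of_mem_primesLE hn)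
            (by linarith)
  have hlt : |g k y| < T k := by
    rw [← mul_pow, ← sq_abs, abs_mul, abs_of_pos (inv_pos.mpr (hT0 k))] at hk
    have := (sq_lt_one_iff₀ (mul_nonneg (inv_pos.mpr (hT0 k)).le (abs_nonneg _))).mp hk
    rwa [inv_mul_lt_iff₀ (hT0 k), mul_one] at this
  have := (abs_lt.mp hlt).1
  rw [hg] at this
  simp only [Finset.sum_sub_distrib] at this
  change T k ≤ _
  linarith

lemma ae_eventually_sum_le_rpow {a b α ε : ℝ} (ha0 : 0 < a) (ha1 : a < 1)
    (hα : 1 < α) (hε : 0 < ε) :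
    ∀ᵐ y ∂(volume.restrict (Set.Icc (0 : ℝ) 1)), ∀ᶠ k : ℕ in atTop,
      ∑ n ∈ Finset.Icc (1 : ℕ) (2 ^ k), (fractIndicator ((n : ℝ) ^ (-a)) (α ^ ((n : ℝ) ^ b) * y)
        + fractIndicator ((n : ℝ) ^ (-a)) (α ^ ((n : ℝ) ^ b) * y + (n : ℝ) ^ (-a)))
        ≤ ((2 : ℝ) ^ k) ^ (1 - a + ε) := by
  have hs : 0 < 1 - a := by linarith
  set w : ℕ → ℝ → ℝ := fun n y => fractIndicator ((n : ℝ) ^ (-a)) (α ^ ((n : ℝ) ^ b) * y)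
        + fractIndicator ((n : ℝ) ^ (-a)) (α ^ ((n : ℝ) ^ b) * y + (n : ℝ) ^ (-a)) with hw
  have hw0 : ∀ n y, 0 ≤ w n y := fun n y =>
    add_nonneg (fractIndicator_nonneg _ _) (fractIndicator_nonneg _ _)
  have hi : ∀ n : ℕ, ∀ c, IntervalIntegrable
      (fun y => fractIndicator ((n : ℝ) ^ (-a)) (α ^ ((n : ℝ) ^ b) * y + c)) volume 0 1 :=
    fun n c => intervalIntegrable_fractIndicator _ _ c 0 1
  have hi0 : ∀ n : ℕ, IntervalIntegrable
      (fun y => fractIndicator ((n : ℝ) ^ (-a)) (α ^ ((n : ℝ) ^ b) * y)) volume 0 1 :=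
    fun n => by simpa using hi n 0
  have hwi : ∀ n, IntervalIntegrable (w n) volume 0 1 := fun n => (hi0 n).add (hi n _)
  have hwb : ∀ n, ∫ y in (0 : ℝ)..1, w n y ≤ 4 * (n : ℝ) ^ (-a) := fun n => by
    have hδ0 : 0 ≤ (n : ℝ) ^ (-a) := by positivity
    have hδ1 := rpow_neg_nat_le_one ha0.le n
    have hu1 := one_le_rpow_rpow (b := b) hα n
    have hc : ∀ c, ∫ y in (0 : ℝ)..1, fractIndicator ((n : ℝ) ^ (-a)) (α ^ ((n : ℝ) ^ b) * y + c)
        ≤ 2 * (n : ℝ) ^ (-a) := fun c => by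
      refine (integral_fractIndicator_mul_add_le hδ0 hδ1 (by linarith) c zero_le_one).trans ?_
      have : 1 / α ^ ((n : ℝ) ^ b) ≤ 1 := by rw [div_le_one (by linarith)]; exact hu1
      nlinarith
    rw [hw]
    simp only
    rw [intervalIntegral.integral_add (hi0 n) (hi n _)]
    have h1 := hc 0
    simp only [add_zero] at h1
    linarith [hc ((n : ℝ) ^ (-a))]
  set T : ℕ → ℝ := fun k => ((2 : ℝ) ^ k) ^ (1 - a + ε) with hT
  have hT0 : ∀ k, 0 < T k := fun k => by positivity
  have hWi : ∀ k : ℕ, IntervalIntegrable (fun y => ∑ n ∈ Finset.Icc 1 (2 ^ k), w n y) volume 0 1 :=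
    fun k => by simpa only [Finset.sum_fn] using IntervalIntegrable.sum _ fun n _ => hwi n
  have key := ae_eventually_lt_one_of_summable_integral
    (f := fun k y => (T k)⁻¹ * ∑ n ∈ Finset.Icc 1 (2 ^ k), w n y)
    (fun k y => mul_nonneg (inv_pos.mpr (hT0 k)).le (Finset.sum_nonneg fun n _ => hw0 n y))
    (fun k => (hWi k).const_mul _) (by
      refine Summable.of_nonneg_of_le (fun k => ?_) (fun k => ?_)
        ((summable_two_pow_rpow (s := -ε) (by linarith)).mul_left (4 / (1 - a)))
      · exact intervalIntegral.integral_nonneg zero_le_one fun y _ =>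
          mul_nonneg (inv_pos.mpr (hT0 k)).le (Finset.sum_nonneg fun n _ => hw0 n y)
      · rw [intervalIntegral.integral_const_mul,
          intervalIntegral.integral_finsetSum (fun n _ => hwi n)]
        have h := sum_rpow_neg_le ha0 ha1 (2 ^ k)
        push_cast at h
        calc (T k)⁻¹ * ∑ n ∈ Finset.Icc 1 (2 ^ k), ∫ y in (0 : ℝ)..1, w n y
            ≤ (T k)⁻¹ * ∑ n ∈ Finset.Icc (1 : ℕ) (2 ^ k), 4 * (n : ℝ) ^ (-a) := by
              have := hT0 k
              gcongr with n hn
              exact hwb n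
          _ ≤ (T k)⁻¹ * (4 * (((2 : ℝ) ^ k) ^ (1 - a) / (1 - a))) := by
              have := hT0 k
              rw [← Finset.mul_sum]
              gcongr
          _ = 4 / (1 - a) * ((2 : ℝ) ^ k) ^ (-ε) := by
              rw [hT]
              simp only
              rw [← Real.rpow_neg (by positivity), show -ε = -(1 - a + ε) + (1 - a) by ring,
                Real.rpow_add (by positivity)]
              ring)
  filter_upwards [key] with y hy
  filter_upwards [hy] with k hk
  rw [inv_mul_lt_iff₀ (hT0 k), mul_one] at hk
  exact hk.le

/-- Two-sided power bounds along powers of two determine the logarithmic growth rate of a monotone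
sequence. -/
lemma tendsto_log_div_log_of_two_pow {A : ℕ → ℕ} (hA : Monotone A) {d e : ℝ}
    (hlow : ∀ j : ℕ, ∀ᶠ k : ℕ in atTop, ((2 : ℝ) ^ k) ^ (d - e / (j + 1)) ≤ A (2 ^ k))
    (hupp : ∀ j : ℕ, ∀ᶠ k : ℕ in atTop, (A (2 ^ k) : ℝ) ≤ ((2 : ℝ) ^ k) ^ (d + e / (j + 1))) :
    Tendsto (fun N : ℕ => Real.log (A N) / Real.log N) atTop (nhds d) := by
  have hl2 : 0 < Real.log 2 := Real.log_pos (by norm_num)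
  have hlogmono : ∀ m n : ℕ, m ≤ n → Real.log m ≤ Real.log n := fun m n h => by
    rcases m.eq_zero_or_pos with rfl | hm
    · simpa using Real.log_natCast_nonneg n
    · exact Real.log_le_log (by exact_mod_cast hm) (by exact_mod_cast h)
  have hpow : Tendsto (fun k : ℕ => Real.log (A (2 ^ k)) / (k * Real.log 2)) atTop (nhds d) := by
    rw [Metric.tendsto_nhds]
    intro ε hε
    obtain ⟨j, hj⟩ := exists_nat_gt (e / ε)
    have hej : e / ((j : ℝ) + 1) < ε := by
      rw [div_lt_iff₀ hε] at hj
      rw [div_lt_iff₀ (by positivity)]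
      linarith
    filter_upwards [hlow j, hupp j, eventually_ge_atTop 1] with k h1 h2 hk
    have hk0 : (0 : ℝ) < k := by exact_mod_cast hk
    have hpos : (0 : ℝ) < A (2 ^ k) := lt_of_lt_of_le (by positivity) h1
    have g1 := Real.log_le_log (by positivity) h1
    have g2 := Real.log_le_log hpos h2
    rw [Real.log_rpow (by positivity), Real.log_pow] at g1 g2
    have g1' := (le_div_iff₀ (mul_pos hk0 hl2)).mpr g1
    have g2' := (div_le_iff₀ (mul_pos hk0 hl2)).mpr g2
    rw [Real.dist_eq, abs_lt]
    constructor <;> linarith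
  have hL : Tendsto (Nat.log 2) atTop atTop := tendsto_atTop.mpr fun m => by
    filter_upwards [eventually_ge_atTop (2 ^ m)] with N hN
    exact Nat.le_log_of_pow_le (by norm_num) hN
  have hratio : Tendsto (fun k : ℕ => (k : ℝ) / ((k : ℝ) + 1)) atTop (nhds 1) :=
    tendsto_natCast_div_add_atTop 1
  have lo : Tendsto (fun k : ℕ => Real.log (A (2 ^ k)) / ((k + 1 : ℕ) * Real.log 2)) atTop
      (nhds d) := by
    have := hpow.mul hratio
    rw [mul_one] at this
    refine this.congr' ?_
    filter_upwards [eventually_ge_atTop 1] with k hk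
    have hk0 : (0 : ℝ) < k := by exact_mod_cast hk
    push_cast
    field_simp
  have up : Tendsto (fun k : ℕ => Real.log (A (2 ^ (k + 1))) / (k * Real.log 2)) atTop
      (nhds d) := by
    have := (hpow.comp (tendsto_add_atTop_nat 1)).div hratio one_ne_zero
    rw [div_one] at this
    refine this.congr' ?_
    filter_upwards [eventually_ge_atTop 1] with k hk
    have hk0 : (0 : ℝ) < k := by exact_mod_cast hk
    simp only [Function.comp_apply, Pi.div_apply]
    push_cast
    field_simp
  refine tendsto_of_tendsto_of_tendsto_of_le_of_le' (lo.comp hL) (up.comp hL) ?_ ?_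
  · filter_upwards [eventually_ge_atTop 2] with N hN
    have h1 : 2 ^ Nat.log 2 N ≤ N := Nat.pow_log_le_self 2 (by omega)
    have h2 : N < 2 ^ (Nat.log 2 N + 1) := Nat.lt_pow_succ_log_self (by norm_num) N
    have h3 := hlogmono _ _ h2.le
    push_cast at h3
    rw [Real.log_pow] at h3
    have hN0 : 0 < Real.log N := Real.log_pos (by exact_mod_cast hN)
    exact div_le_div₀ (Real.log_natCast_nonneg _) (hlogmono _ _ (hA h1)) hN0 h3
  · filter_upwards [eventually_ge_atTop 2] with N hN
    have h1 : 2 ^ Nat.log 2 N ≤ N := Nat.pow_log_le_self 2 (by omega)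
    have h2 : N < 2 ^ (Nat.log 2 N + 1) := Nat.lt_pow_succ_log_self (by norm_num) N
    have h3 := hlogmono _ _ h1
    push_cast at h3
    rw [Real.log_pow] at h3
    have hL0 : 0 < Nat.log 2 N := Nat.log_pos (by norm_num) hN
    exact div_le_div₀ (Real.log_natCast_nonneg _) (hlogmono _ _ (hA h2.le))
      (mul_pos (by exact_mod_cast hL0) hl2) h3

lemma fractIndicator_le_ite_distNearestInt (δ x : ℝ) :
    fractIndicator δ x ≤ if distNearestInt x < δ then 1 else 0 := by
  by_cases h : Int.fract x < δ
  · have : distNearestInt x < δ := by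
      rw [distNearestInt, abs_sub_round_eq_min]
      exact (min_le_left _ _).trans_lt h
    rw [if_pos this]
    exact fractIndicator_le_one δ x
  · rw [fractIndicator, if_neg h]
    split_ifs <;> norm_num

lemma ite_distNearestInt_le {δ : ℝ} (hδ : δ ≤ 1) (x : ℝ) :
    (if distNearestInt x < δ then (1 : ℝ) else 0)
      ≤ fractIndicator δ x + fractIndicator δ (x + δ) := by
  have p1 := fractIndicator_nonneg δ x
  have p2 := fractIndicator_nonneg δ (x + δ)
  split_ifs with h
  · rw [distNearestInt, abs_sub_round_eq_min, min_lt_iff] at h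
    rcases h with h | h
    · have : fractIndicator δ x = 1 := if_pos h
      linarith
    · have hf : Int.fract (x + δ) = Int.fract x + δ - 1 := by
        rw [Int.fract_eq_iff]
        refine ⟨by linarith, by linarith [Int.fract_lt_one x], ⌊x⌋ + 1, ?_⟩
        have := Int.self_sub_floor x
        push_cast
        linarith
      have : fractIndicator δ (x + δ) = 1 := if_pos (by rw [hf]; linarith [Int.fract_lt_one x])
      linarith
  · linarith

/-- for `a ∈ (0,1)`, `b > a`, `α > 1`, for a.e. `y ∈ [0,1]` the set
`{n prime : ⟨α^{n^b} y⟩ < n^{-a}}` has mass dimension `1 − a`. -/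
theorem primes_hitting_dimension (a b α : ℝ) (ha : a ∈ Set.Ioo (0:ℝ) 1)
    (hb : a < b) (hα : 1 < α) :
    ∀ᵐ y ∂(volume.restrict (Set.Icc (0:ℝ) 1)),
      Tendsto (fun N : ℕ =>
          Real.log
            ((({n : ℕ | n.Prime ∧ distNearestInt (α ^ ((n:ℝ) ^ b) * y) < (n:ℝ) ^ (-a)}
              ∩ Set.Icc 1 N).ncard : ℝ)) / Real.log N)
        atTop (nhds (1 - a)) := by
  obtain ⟨ha0, ha1⟩ := ha
  obtain ⟨β, haβ, hβ⟩ := exists_between (lt_min hb ha1)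
  obtain ⟨hβb, hβ1⟩ := lt_min_iff.mp hβ
  set e : ℝ := (β - a) / 4 with he
  have he0 : 0 < e := by rw [he]; linarith
  have hej : ∀ j : ℕ, 0 < e / ((j : ℝ) + 1) ∧ e / ((j : ℝ) + 1) ≤ e := fun j =>
    ⟨by positivity, div_le_self he0.le (by linarith [Nat.cast_nonneg (α := ℝ) j])⟩
  filter_upwards [ae_all_iff.mpr fun j : ℕ => ae_eventually_rpow_le_sum ha0 ha1 (ha0.trans haβ) hβ1
      hβb.le hα (hej j).1 (by linarith [(hej j).2]),
    ae_all_iff.mpr fun j : ℕ => ae_eventually_sum_le_rpow (b := b) ha0 ha1 hα (hej j).1]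
    with y hlow hupp
  have hcard : ∀ N : ℕ, ((({n : ℕ | n.Prime ∧ distNearestInt (α ^ ((n:ℝ) ^ b) * y) < (n:ℝ) ^ (-a)}
      ∩ Set.Icc 1 N).ncard : ℕ) : ℝ) = ∑ n ∈ Nat.primesLE N,
        if distNearestInt (α ^ ((n:ℝ) ^ b) * y) < (n:ℝ) ^ (-a) then (1 : ℝ) else 0 := fun N => by
    have hset : {n : ℕ | n.Prime ∧ distNearestInt (α ^ ((n:ℝ) ^ b) * y) < (n:ℝ) ^ (-a)}
        ∩ Set.Icc 1 N = ((Nat.primesLE N).filter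
          fun n : ℕ => distNearestInt (α ^ ((n:ℝ) ^ b) * y) < (n:ℝ) ^ (-a) : Finset ℕ) := by
      ext n
      simp only [Set.mem_inter_iff, Set.mem_ofPred_eq, Set.mem_Icc, Finset.coe_filter,
        Nat.mem_primesLE]
      exact ⟨fun h => ⟨⟨h.2.2, h.1.1⟩, h.1.2⟩, fun h => ⟨⟨h.1.2, h.2⟩, h.1.2.one_le, h.1.1⟩⟩
    rw [hset, Set.ncard_coe_finset, Finset.sum_boole]
  refine tendsto_log_div_log_of_two_pow (e := e) (A := fun N => ({n : ℕ | n.Prime ∧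
    distNearestInt (α ^ ((n:ℝ) ^ b) * y) < (n:ℝ) ^ (-a)} ∩ Set.Icc 1 N).ncard) ?_ ?_ ?_
  · exact fun M N h => Set.ncard_le_ncard
      (Set.inter_subset_inter_right _ (Set.Icc_subset_Icc_right h))
      ((Set.finite_Icc 1 N).inter_of_right _)
  · intro j
    filter_upwards [hlow j] with k hk
    rw [hcard]
    exact hk.trans (Finset.sum_le_sum fun n _ => fractIndicator_le_ite_distNearestInt _ _)
  · intro j
    filter_upwards [hupp j] with k hk
    rw [hcard]
    refine le_trans ?_ hk
    refine (Finset.sum_le_sum fun n _ =>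
      ite_distNearestInt_le (rpow_neg_nat_le_one ha0.le n) _).trans ?_
    exact Finset.sum_le_sum_of_subset_of_nonneg
      (fun p hp => Finset.mem_Icc.mpr
        ⟨(Nat.prime_of_mem_primesLE hp).one_le, Nat.le_of_mem_primesLE hp⟩)
      (fun _ _ _ => add_nonneg (fractIndicator_nonneg _ _) (fractIndicator_nonneg _ _))
end
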